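/- Let F be a finite field of characteristic ≠ 2, q a nondegenerate quadratic form on V, and suppose dim V ≡ 0, 1, or 3 (mod 4). Then every semisimple element t of Spin(V,q) is real in Spin(V,q): there exists s ∈ Spin(V,q) with s·t·s⁻¹ = t⁻¹. -/

import Mathlib

open CliffordAlgebra

/-- An element of the Spin group: a unit of the Clifford algebra lying in the Clifford
(Lipschitz) group, in the even part, with spinor norm `N(u) = reverse(u)·u = 1`. -/
def IsSpinElt {F V : Type*} [Field F] [AddCommGroup V] [Module F V]
    (Q : QuadraticForm F V) (x : (CliffordAlgebra Q)ˣ) : Prop :=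
  x ∈ lipschitzGroup Q ∧ (x : CliffordAlgebra Q) ∈ evenOdd Q 0 ∧
    reverse (x : CliffordAlgebra Q) * (x : CliffordAlgebra Q) = 1

section Part1

open QuadraticMap

variable {F V : Type*} [Field F] [AddCommGroup V] [Module F V]

/-- reflection -/
def refl' (Q : QuadraticForm F V) (e : V) : Module.End F V :=
  1 - (Q e)⁻¹ • (polarBilin Q e).smulRight e

theorem refl'_apply (Q : QuadraticForm F V) (e v : V) :
    refl' Q e v = v - ((Q e)⁻¹ * polar Q e v) • e := by
  simp [refl', mul_smul]

/-- product of reflections -/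
def RL (Q : QuadraticForm F V) (L : List V) : Module.End F V := (L.map (refl' Q)).prod

/-- product of vectors in the Clifford algebra -/
def sig (Q : QuadraticForm F V) (L : List V) : CliffordAlgebra Q := (L.map (ι Q)).prod

/-- orthogonal anisotropic list -/
def GoodL (Q : QuadraticForm F V) (L : List V) : Prop :=
  (∀ e ∈ L, Q e ≠ 0) ∧ L.Pairwise (fun x y => polar Q x y = 0)

theorem RL_nil (Q : QuadraticForm F V) : RL Q [] = 1 := rfl
theorem RL_cons (Q : QuadraticForm F V) (e : V) (L : List V) :
    RL Q (e :: L) = refl' Q e * RL Q L := by simp [RL]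
theorem RL_append (Q : QuadraticForm F V) (L M : List V) :
    RL Q (L ++ M) = RL Q L * RL Q M := by simp [RL]
theorem sig_nil (Q : QuadraticForm F V) : sig Q [] = 1 := rfl
theorem sig_cons (Q : QuadraticForm F V) (e : V) (L : List V) :
    sig Q (e :: L) = ι Q e * sig Q L := by simp [sig]
theorem sig_append (Q : QuadraticForm F V) (L M : List V) :
    sig Q (L ++ M) = sig Q L * sig Q M := by simp [sig]

theorem refl'_act (Q : QuadraticForm F V) (e v : V) (he : Q e ≠ 0) :
    involute (ι Q e) * ι Q v = ι Q (refl' Q e v) * ι Q e := by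
  have h := ι_mul_ι_add_swap (Q := Q) e v
  rw [refl'_apply, map_sub, map_smul, sub_mul, smul_mul_assoc, ι_sq_scalar, involute_ι,
    Algebra.smul_def, ← RingHom.map_mul, mul_right_comm,
    inv_mul_cancel₀ he, one_mul, ← h]
  simp

theorem RL_act (Q : QuadraticForm F V) (L : List V) (hL : ∀ e ∈ L, Q e ≠ 0) (v : V) :
    involute (sig Q L) * ι Q v = ι Q (RL Q L v) * sig Q L := by
  induction L generalizing v with
  | nil => simp [sig_nil, RL_nil]
  | cons e L ih =>
    have h1 := ih (fun x hx => hL x (by simp [hx])) v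
    rw [sig_cons, RL_cons, map_mul, mul_assoc, h1, ← mul_assoc, refl'_act Q e _ (hL e (by simp)),
      mul_assoc]
    rfl

theorem iota_unit (Q : QuadraticForm F V) (e : V) (he : Q e ≠ 0) :
    ∃ u : (CliffordAlgebra Q)ˣ, u ∈ lipschitzGroup Q ∧ (u : CliffordAlgebra Q) = ι Q e := by
  have h1 : ι Q e * ((Q e)⁻¹ • ι Q e) = 1 := by
    rw [mul_smul_comm, ι_sq_scalar, Algebra.smul_def, ← map_mul, inv_mul_cancel₀ he, map_one]
  have h2 : ((Q e)⁻¹ • ι Q e) * ι Q e = 1 := by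
    rw [smul_mul_assoc, ι_sq_scalar, Algebra.smul_def, ← map_mul, inv_mul_cancel₀ he, map_one]
  exact ⟨⟨_, _, h1, h2⟩, Subgroup.subset_closure ⟨e, rfl⟩, rfl⟩

theorem sig_unit (Q : QuadraticForm F V) (L : List V) (hL : ∀ e ∈ L, Q e ≠ 0) :
    ∃ u : (CliffordAlgebra Q)ˣ, u ∈ lipschitzGroup Q ∧ (u : CliffordAlgebra Q) = sig Q L := by
  induction L with
  | nil => exact ⟨1, one_mem _, rfl⟩
  | cons e L ih =>
    obtain ⟨u, hu, hu'⟩ := ih (fun x hx => hL x (by simp [hx]))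
    obtain ⟨w, hw, hw'⟩ := iota_unit Q e (hL e (by simp))
    exact ⟨w * u, mul_mem hw hu, by rw [sig_cons, Units.val_mul, hu', hw']⟩

theorem sig_mem (Q : QuadraticForm F V) (L : List V) :
    sig Q L ∈ evenOdd Q (L.length : ZMod 2) := by
  induction L with
  | nil => simpa [sig_nil] using (one_le_evenOdd_zero Q) (Submodule.one_le.mp le_rfl)
  | cons e L ih =>
    rw [sig_cons, List.length_cons, Nat.cast_add, add_comm, Nat.cast_one]
    exact evenOdd_mul_le Q _ _ (Submodule.mul_mem_mul (ι_mem_evenOdd_one Q e) ih)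

theorem sig_reverse (Q : QuadraticForm F V) (L : List V) :
    reverse (sig Q L) = sig Q L.reverse := by
  induction L with
  | nil => simp [sig_nil]
  | cons e L ih =>
    rw [sig_cons, reverse.map_mul, ih, reverse_ι, List.reverse_cons, sig_append, sig_cons, sig_nil,
      mul_one]

/-- sign of reversal -/
def eps : ℕ → ℤ
  | 0 => 1
  | n + 1 => (-1) ^ n * eps n

theorem eps_add_four (n : ℕ) : eps (n + 4) = eps n := by
  simp only [eps, pow_succ]
  have : ((-1 : ℤ) ^ n) * (-1) ^ n = 1 := by rw [← mul_pow]; simp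
  linear_combination (eps n) * ((-1 : ℤ) ^ n * (-1) ^ n + 1) * this

theorem eps_mod (k l : ℕ) (h : k % 4 = l % 4) : eps k = eps l := by
  have key : ∀ n, eps n = eps (n % 4) := by
    intro n
    induction n using Nat.strong_induction_on with
    | _ n ih =>
      by_cases hn : n < 4
      · rw [Nat.mod_eq_of_lt hn]
      · obtain ⟨m, rfl⟩ : ∃ m, n = m + 4 := ⟨n - 4, by omega⟩
        rw [eps_add_four, ih m (by omega), Nat.add_mod_right]
  rw [key k, key l, h]

theorem eps_sq (n : ℕ) : eps n * eps n = 1 := by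
  induction n with
  | zero => rfl
  | succ n ih =>
    have : ((-1 : ℤ) ^ n) * (-1) ^ n = 1 := by rw [← mul_pow]; simp
    simp only [eps]
    linear_combination (-1 : ℤ) ^ n * (-1) ^ n * ih + this

theorem sig_comm_one (Q : QuadraticForm F V) (e : V) (L : List V)
    (h : ∀ x ∈ L, polar Q e x = 0) : sig Q L * ι Q e = ((-1 : ℤ) ^ L.length) • (ι Q e * sig Q L) := by
  induction L with
  | nil => simp [sig_nil]
  | cons x L ih =>
    have h1 := ih (fun y hy => h y (by simp [hy]))
    have h2 := ι_mul_ι_add_swap (Q := Q) e x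
    rw [h x (by simp), map_zero] at h2
    have h3 : ι Q x * ι Q e = - (ι Q e * ι Q x) := by
      rw [eq_neg_iff_add_eq_zero, add_comm]; exact h2
    rw [sig_cons, mul_assoc, h1, mul_smul_comm, ← mul_assoc, h3, List.length_cons, pow_succ,
      neg_mul, mul_neg_one, neg_smul, smul_neg, mul_assoc]

theorem sig_reverse_good (Q : QuadraticForm F V) (L : List V) (hL : GoodL Q L) :
    reverse (sig Q L) = eps L.length • sig Q L := by
  induction L with
  | nil => simp [sig_nil, eps]
  | cons e L ih =>
    have hp := List.pairwise_cons.1 hL.2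
    rw [sig_cons, reverse.map_mul, ih ⟨fun x hx => hL.1 x (by simp [hx]), hp.2⟩, reverse_ι,
      smul_mul_assoc, sig_comm_one Q e L hp.1, List.length_cons, eps, smul_smul, mul_comm]

theorem sig_norm (Q : QuadraticForm F V) (L : List V) :
    reverse (sig Q L) * sig Q L = algebraMap F _ (L.map Q).prod := by
  induction L with
  | nil => simp [sig_nil]
  | cons e L ih =>
    rw [sig_cons, reverse.map_mul, reverse_ι, mul_assoc, ← mul_assoc (ι Q e), ι_sq_scalar,
      ← mul_assoc, ← Algebra.commutes, mul_assoc, ih, List.map_cons, List.prod_cons, map_mul]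

theorem contract_eq (Q : QuadraticForm F V) (v : V) (x : CliffordAlgebra Q) :
    ι Q v * x - involute x * ι Q v = contractLeft (polarBilin Q v) x := by
  induction x using CliffordAlgebra.left_induction with
  | algebraMap r => simp [contractLeft_algebraMap, Algebra.commutes]
  | add x y hx hy => rw [map_add, map_add, ← hx, ← hy]; noncomm_ring
  | ι_mul x a hx =>
    have h := ι_mul_ι_add_swap (Q := Q) v a
    rw [contractLeft_ι_mul, ← hx, map_mul, involute_ι, polarBilin_apply_apply, Algebra.smul_def, ← h]
    noncomm_ring

/-- subalgebra generated by some vectors -/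
def subC (Q : QuadraticForm F V) (s : Set V) : Subalgebra F (CliffordAlgebra Q) :=
  Algebra.adjoin F (ι Q '' s)

theorem subC_contract (Q : QuadraticForm F V) (s : Set V) (d : Module.Dual F V)
    (hd : ∀ v ∈ s, d v = 0) (x : CliffordAlgebra Q) (hx : x ∈ subC Q s) :
    contractLeft d x = 0 := by
  have key : ∀ y ∈ subC Q s, ∀ z, contractLeft d z = 0 → contractLeft d (y * z) = 0 := by
    intro y hy
    induction hy using Algebra.adjoin_induction with
    | mem y hy =>
      obtain ⟨v, hv, rfl⟩ := hy
      intro z hz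
      rw [contractLeft_ι_mul, hd v hv, hz]; simp
    | algebraMap r => intro z hz; rw [contractLeft_algebraMap_mul, hz, mul_zero]
    | add a b _ _ ha hb => intro z hz; rw [add_mul, map_add, ha z hz, hb z hz, add_zero]
    | mul a b _ _ ha hb => intro z hz; rw [mul_assoc]; exact ha _ (hb _ hz)
  simpa using key x hx 1 (contractLeft_one _ _)

theorem subC_insert (Q : QuadraticForm F V) (s : Set V) (e : V) (x : CliffordAlgebra Q)
    (hx : x ∈ subC Q (insert e s)) :
    ∃ a ∈ subC Q s, ∃ b ∈ subC Q s, x = a + ι Q e * b := by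
  have key : ∀ y ∈ subC Q (insert e s), ∀ z, (∃ a ∈ subC Q s, ∃ b ∈ subC Q s, z = a + ι Q e * b) →
      (∃ a ∈ subC Q s, ∃ b ∈ subC Q s, y * z = a + ι Q e * b) := by
    intro y hy
    induction hy using Algebra.adjoin_induction with
    | mem y hy =>
      obtain ⟨v, hv, rfl⟩ := hy
      rintro z ⟨a, ha, b, hb, rfl⟩
      rcases hv with rfl | hv
      · refine ⟨algebraMap F _ (Q v) * b, mul_mem (Subalgebra.algebraMap_mem _ _) hb, a, ha, ?_⟩
        rw [mul_add, ← mul_assoc, ι_sq_scalar, add_comm]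
      · have hv' : ι Q v ∈ subC Q s := Algebra.subset_adjoin ⟨v, hv, rfl⟩
        have h := ι_mul_ι_add_swap (Q := Q) v e
        refine ⟨ι Q v * a + algebraMap F _ (polar Q v e) * b,
          add_mem (mul_mem hv' ha) (mul_mem (Subalgebra.algebraMap_mem _ _) hb),
          - (ι Q v * b), neg_mem (mul_mem hv' hb), ?_⟩
        rw [← h]; noncomm_ring
    | algebraMap r =>
      rintro z ⟨a, ha, b, hb, rfl⟩
      refine ⟨_, mul_mem (Subalgebra.algebraMap_mem _ r) ha, _, mul_mem (Subalgebra.algebraMap_mem _ r) hb, ?_⟩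
      rw [mul_add, ← mul_assoc, ← mul_assoc, Algebra.commutes r (ι Q e)]
    | add p q _ _ hp hq =>
      intro z hz
      obtain ⟨a, ha, b, hb, h1⟩ := hp z hz
      obtain ⟨a', ha', b', hb', h2⟩ := hq z hz
      refine ⟨_, add_mem ha ha', _, add_mem hb hb', ?_⟩
      rw [add_mul, h1, h2]; noncomm_ring
    | mul p q _ _ hp hq => intro z hz; rw [mul_assoc]; exact hp _ (hq _ hz)
  simpa using key x hx 1 ⟨1, one_mem _, 0, zero_mem _, by simp⟩

theorem contract_scalar [FiniteDimensional F V] (Q : QuadraticForm F V) (x : CliffordAlgebra Q)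
    (hx : ∀ d : Module.Dual F V, contractLeft d x = 0) : ∃ c : F, x = algebraMap F _ c := by
  classical
  let b := Module.finBasis F V
  have key : ∀ s : Finset (Fin (Module.finrank F V)), x ∈ subC Q (b '' s) →
      ∃ c : F, x = algebraMap F _ c := by
    intro s
    induction s using Finset.induction_on with
    | empty =>
      intro h
      rw [subC] at h
      simp only [Finset.coe_empty, Set.image_empty, Algebra.adjoin_empty] at h
      obtain ⟨c, hc⟩ := Algebra.mem_bot.1 h
      exact ⟨c, hc.symm⟩
    | insert i s hi ih =>
      intro h
      rw [Finset.coe_insert, Set.image_insert_eq] at h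
      obtain ⟨a, ha, y, hy, hxy⟩ := subC_insert Q _ _ x h
      have hd : ∀ v ∈ b '' (s : Set (Fin (Module.finrank F V))), b.coord i v = 0 := by
        rintro _ ⟨j, hj, rfl⟩
        have : j ≠ i := by rintro rfl; exact hi hj
        simp [this]
      have h1 := hx (b.coord i)
      rw [hxy, map_add, contractLeft_ι_mul, subC_contract Q _ _ hd a ha,
        subC_contract Q _ _ hd y hy] at h1
      simp at h1
      apply ih
      rw [hxy, h1]; simpa using ha
  apply key Finset.univ
  have : subC Q (b '' (Finset.univ : Finset (Fin (Module.finrank F V)))) = ⊤ := by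
    rw [eq_top_iff, ← adjoin_range_ι]
    apply Algebra.adjoin_le
    rintro _ ⟨v, rfl⟩
    rw [← b.sum_repr v, map_sum]
    refine sum_mem fun i _ => ?_
    rw [map_smul]
    exact Subalgebra.smul_mem _ (Algebra.subset_adjoin (Set.mem_image_of_mem _
      (Set.mem_image_of_mem _ (by simp)))) _
  rw [this]; trivial

theorem twisted_center [FiniteDimensional F V] (Q : QuadraticForm F V)
    (hQ : LinearMap.BilinForm.Nondegenerate (polarBilin Q))
    (x : CliffordAlgebra Q) (hx : ∀ v, involute x * ι Q v = ι Q v * x) :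
    ∃ c : F, x = algebraMap F _ c := by
  apply contract_scalar
  intro d
  have h1 : ∀ v, contractLeft (polarBilin Q v) x = 0 := by
    intro v; rw [← contract_eq, hx v, sub_self]
  have h2 := (LinearMap.BilinForm.toDual (polarBilin Q) hQ).surjective d
  obtain ⟨v, rfl⟩ := h2
  exact h1 v

theorem same_action [FiniteDimensional F V] (hF2 : (2 : F) ≠ 0) (Q : QuadraticForm F V)
    (hQ : LinearMap.BilinForm.Nondegenerate (polarBilin Q)) (T : Module.End F V)
    (x y : (CliffordAlgebra Q)ˣ)
    (hx : ∀ v, involute (x : CliffordAlgebra Q) * ι Q v = ι Q (T v) * x)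
    (hy : ∀ v, involute (y : CliffordAlgebra Q) * ι Q v = ι Q (T v) * y) :
    ∃ c : F, c ≠ 0 ∧ (x : CliffordAlgebra Q) = c • (y : CliffordAlgebra Q) := by
  have hyi : involute ((y⁻¹ : (CliffordAlgebra Q)ˣ) : CliffordAlgebra Q) *
      involute (y : CliffordAlgebra Q) = 1 := by
    rw [← map_mul, Units.inv_mul, map_one]
  obtain ⟨c, hc⟩ := twisted_center Q hQ ((y⁻¹ * x : (CliffordAlgebra Q)ˣ) : CliffordAlgebra Q) (by
    intro v
    have e1 : ι Q (T v) = involute (y : CliffordAlgebra Q) * ι Q v * ((y⁻¹ : (CliffordAlgebra Q)ˣ) : CliffordAlgebra Q) := by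
      rw [hy v, mul_assoc, Units.mul_inv, mul_one]
    rw [Units.val_mul, map_mul, mul_assoc, hx v, e1]
    simp only [← mul_assoc]
    rw [hyi, one_mul])
  have hxy : (x : CliffordAlgebra Q) = c • (y : CliffordAlgebra Q) := by
    have : (x : CliffordAlgebra Q) = y * ((y⁻¹ * x : (CliffordAlgebra Q)ˣ) : CliffordAlgebra Q) := by
      rw [← Units.val_mul, mul_inv_cancel_left]
    rw [this, hc, ← Algebra.commutes, Algebra.smul_def]
  refine ⟨c, ?_, hxy⟩
  rintro rfl
  rw [zero_smul] at hxy
  have h1 : (x : CliffordAlgebra Q) * ((x⁻¹ : (CliffordAlgebra Q)ˣ) : CliffordAlgebra Q) = 1 := Units.mul_inv x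
  rw [hxy, zero_mul] at h1
  haveI : Invertible (2 : F) := invertibleOfNonzero hF2
  exact zero_ne_one h1

end Part1

section Part2

open QuadraticMap

variable {F V : Type*} [Field F] [AddCommGroup V] [Module F V]

theorem final_lemma [FiniteDimensional F V] (hF2 : (2 : F) ≠ 0) (Q : QuadraticForm F V)
    (hQ : LinearMap.BilinForm.Nondegenerate (polarBilin Q)) (T : Module.End F V)
    (t : (CliffordAlgebra Q)ˣ) (ht : IsSpinElt Q t)
    (hT : ∀ v, involute (t : CliffordAlgebra Q) * ι Q v = ι Q (T v) * t)
    (L L' : List V) (hL : GoodL Q L) (hL' : GoodL Q L') (hTL : ∀ v, RL Q L' (RL Q L v) = T v)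
    (hlen : L.length % 2 = 0) (hlen' : L.length % 4 = L'.length % 4)
    (hsq : IsSquare (L.map Q).prod) :
    ∃ s : (CliffordAlgebra Q)ˣ, IsSpinElt Q s ∧ s * t * s⁻¹ = t⁻¹ := by
  have hs : ∃ s : (CliffordAlgebra Q)ˣ, s ∈ lipschitzGroup Q ∧ ∃ r : F,
      (s : CliffordAlgebra Q) = r • sig Q L ∧ r * r * (L.map Q).prod = 1 := by
    obtain ⟨r, hr⟩ := hsq
    have hpr : (L.map Q).prod ≠ 0 := by
      rw [Ne, List.prod_eq_zero_iff, List.mem_map]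
      rintro ⟨e, he, h0⟩
      exact hL.1 e he h0
    have hr0 : r ≠ 0 := by rintro rfl; exact hpr (by simpa using hr)
    cases L with
    | nil => exact ⟨1, one_mem _, 1, by simp [sig_nil], by simp⟩
    | cons e L =>
      obtain ⟨u, hu, hu'⟩ := sig_unit Q L (fun x hx => hL.1 x (by simp [hx]))
      obtain ⟨w, hw, hw'⟩ := iota_unit Q (r⁻¹ • e) (by
        rw [QuadraticMap.map_smul]
        simp [hr0, hL.1 e (by simp)])
      refine ⟨w * u, mul_mem hw hu, r⁻¹, ?_, ?_⟩
      · rw [Units.val_mul, hu', hw', sig_cons, LinearMap.map_smul, smul_mul_assoc]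
      · rw [hr]; field_simp
  obtain ⟨s, hsl, r, hsr, hr1⟩ := hs
  obtain ⟨u, hu, hu'⟩ := sig_unit Q L hL.1
  obtain ⟨w, hw, hw'⟩ := sig_unit Q L' hL'.1
  obtain ⟨c, hc0, hc⟩ := same_action hF2 Q hQ T t (w * u) hT (by
    intro v
    rw [Units.val_mul, hu', hw', ← hTL, map_mul, mul_assoc, RL_act Q L hL.1, ← mul_assoc,
      RL_act Q L' hL'.1, mul_assoc])
  rw [Units.val_mul, hu', hw'] at hc
  refine ⟨s, ⟨hsl, ?_, ?_⟩, ?_⟩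
  · rw [hsr]
    refine Submodule.smul_mem _ _ ?_
    have := sig_mem Q L
    rwa [(ZMod.natCast_eq_zero_iff _ 2).2 (Nat.dvd_of_mod_eq_zero hlen)] at this
  · rw [hsr, map_smul, smul_mul_smul_comm, sig_norm, Algebra.smul_def, ← RingHom.map_mul, hr1, map_one]
  · have hti : ((t⁻¹ : (CliffordAlgebra Q)ˣ) : CliffordAlgebra Q) = reverse (t : CliffordAlgebra Q) := by
      rw [← mul_one (reverse (t : CliffordAlgebra Q)), ← Units.mul_inv t, ← mul_assoc, ht.2.2, one_mul]
    rw [mul_inv_eq_iff_eq_mul]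
    ext
    rw [Units.val_mul, Units.val_mul, hti, hc, map_smul, reverse.map_mul, sig_reverse_good Q L hL,
      sig_reverse_good Q L' hL', eps_mod _ _ hlen', hsr]
    simp only [smul_mul_assoc, mul_smul_comm, mul_assoc, smul_smul, eps_sq, one_smul, mul_comm c r]

theorem Q_refl' (Q : QuadraticForm F V) (e v : V) (he : Q e ≠ 0) : Q (refl' Q e v) = Q v := by
  rw [refl'_apply, sub_eq_add_neg, ← neg_smul, QuadraticMap.map_add Q, QuadraticMap.map_smul, polar_smul_right,
    polar_comm Q v e]
  simp only [smul_eq_mul]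
  field_simp
  ring

theorem refl'_refl' (Q : QuadraticForm F V) (e v : V) (he : Q e ≠ 0) :
    refl' Q e (refl' Q e v) = v := by
  simp only [refl'_apply, polar_sub_right, polar_smul_right, polar_self, smul_eq_mul, nsmul_eq_mul]
  rw [sub_sub, ← add_smul, sub_eq_self]
  convert zero_smul F e using 2
  push_cast
  field_simp
  ring

theorem lip_T (hF2 : (2 : F) ≠ 0) (Q : QuadraticForm F V) (x : (CliffordAlgebra Q)ˣ)
    (hx : x ∈ lipschitzGroup Q) : ∃ T : V ≃ₗ[F] V, (∀ v, Q (T v) = Q v) ∧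
      ∀ v, involute (x : CliffordAlgebra Q) * ι Q v = ι Q (T v) * x := by
  have : Invertible (2 : F) := invertibleOfNonzero hF2
  induction hx using Subgroup.closure_induction with
  | mem x hx =>
    obtain ⟨e, he⟩ := hx
    let i1 := x.invertible
    let i2 : Invertible (ι Q e) := by rwa [he]
    let i3 : Invertible (Q e) := invertibleOfInvertibleι Q e
    have he0 : Q e ≠ 0 := Invertible.ne_zero (Q e)
    refine ⟨LinearEquiv.ofLinearMap (refl' Q e) (refl' Q e) (by ext v; simp [refl'_refl' Q e _ he0])
      (by ext v; simp [refl'_refl' Q e _ he0]), fun v => Q_refl' Q e v he0, fun v => ?_⟩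
    rw [← he]
    exact refl'_act Q e v he0
  | one => exact ⟨LinearEquiv.refl F V, by simp, by simp⟩
  | mul x y _ _ hx hy =>
    obtain ⟨S, hS, hS'⟩ := hx
    obtain ⟨T, hT, hT'⟩ := hy
    refine ⟨T.trans S, fun v => by simp [hS, hT], fun v => ?_⟩
    rw [Units.val_mul, map_mul, mul_assoc, hT', ← mul_assoc, hS', mul_assoc]; rfl
  | inv x _ hx =>
    obtain ⟨S, hS, hS'⟩ := hx
    refine ⟨S.symm, fun v => by rw [← hS (S.symm v)]; simp, fun v => ?_⟩
    have h1 := hS' (S.symm v)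
    rw [LinearEquiv.apply_symm_apply] at h1
    have h2 : involute ((x⁻¹ : (CliffordAlgebra Q)ˣ) : CliffordAlgebra Q) *
      involute (x : CliffordAlgebra Q) = 1 := by
      rw [← map_mul, Units.inv_mul, map_one]
    have h3 : ι Q v = ι Q v * x * ((x⁻¹ : (CliffordAlgebra Q)ˣ) : CliffordAlgebra Q) := by
      rw [mul_assoc, Units.mul_inv, mul_one]
    rw [h3, ← h1]
    simp only [← mul_assoc]
    rw [h2, one_mul]

theorem iota_inj (hF2 : (2 : F) ≠ 0) (Q : QuadraticForm F V)
    (hQ : LinearMap.BilinForm.Nondegenerate (polarBilin Q)) (v w : V) (h : ι Q v = ι Q w) : v = w := by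
  have : Invertible (2 : F) := invertibleOfNonzero hF2
  rw [← sub_eq_zero] at h ⊢
  rw [← map_sub] at h
  apply hQ.1
  intro z
  have h1 := ι_mul_ι_add_swap (Q := Q) (v - w) z
  rw [h, zero_mul, mul_zero, zero_add] at h1
  exact (RingHom.injective (algebraMap F (CliffordAlgebra Q)) (by
    rw [polarBilin_apply_apply, ← h1, map_zero])).symm

theorem act_pow (Q : QuadraticForm F V) (T : V ≃ₗ[F] V) (t : (CliffordAlgebra Q)ˣ)
    (hT : ∀ v, involute (t : CliffordAlgebra Q) * ι Q v = ι Q (T v) * t) (n : ℕ) (v : V) :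
    involute ((t ^ n : (CliffordAlgebra Q)ˣ) : CliffordAlgebra Q) * ι Q v = ι Q ((T ^ n) v) *
      ((t ^ n : (CliffordAlgebra Q)ˣ) : CliffordAlgebra Q) := by
  induction n generalizing v with
  | zero => simp
  | succ n ih =>
    rw [pow_succ, Units.val_mul, map_mul, mul_assoc, hT, ← mul_assoc, ih, pow_succ, mul_assoc]; rfl

theorem order_T [Finite F] [FiniteDimensional F V] (hF2 : (2 : F) ≠ 0) (Q : QuadraticForm F V)
    (hQ : LinearMap.BilinForm.Nondegenerate (polarBilin Q)) (T : V ≃ₗ[F] V)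
    (t : (CliffordAlgebra Q)ˣ)
    (hT : ∀ v, involute (t : CliffordAlgebra Q) * ι Q v = ι Q (T v) * t)
    (hss : Module.End.IsSemisimple (LinearMap.mulLeft F (t : CliffordAlgebra Q))) :
    ∃ N : ℕ, (N : F) ≠ 0 ∧ T ^ N = 1 := by
  have : Finite V := Module.finite_of_finite F
  have : Finite (V ≃ₗ[F] V) := Finite.of_injective (fun (e : V ≃ₗ[F] V) => (e : V → V)) DFunLike.coe_injective
  have hN1 : 0 < orderOf T := orderOf_pos T
  obtain ⟨c, hc0, hc⟩ := same_action hF2 Q hQ 1 (t ^ orderOf T) 1 (by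
    intro v
    rw [act_pow Q T t hT, pow_orderOf_eq_one]; rfl) (by simp)
  have hM1 : 0 < orderOf (Units.mk0 c hc0) := orderOf_pos _
  obtain ⟨K, hK0, hK⟩ : ∃ K : ℕ, 0 < K ∧ t ^ K = 1 := by
    refine ⟨orderOf T * orderOf (Units.mk0 c hc0), Nat.mul_pos hN1 hM1, ?_⟩
    ext
    have h2 : c ^ orderOf (Units.mk0 c hc0) = 1 := by
      have := congrArg Units.val (pow_orderOf_eq_one (Units.mk0 c hc0))
      rwa [Units.val_pow_eq_pow_val, Units.val_mk0, Units.val_one] at this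
    rw [pow_mul, Units.val_pow_eq_pow_val, hc, Units.val_one, smul_pow, one_pow, h2, one_smul]
  obtain ⟨p, hp⟩ := CharP.exists F
  have hp0 : p.Prime := (CharP.char_is_prime_or_zero F p).resolve_right (by
    rintro rfl
    have := CharP.charP_to_charZero F
    exact not_finite F)
  have : Fact p.Prime := ⟨hp0⟩
  obtain ⟨a, N, hN, rfl⟩ := Nat.exists_eq_pow_mul_and_not_dvd hK0.ne' p hp0.ne_one
  refine ⟨N, fun h => hN ((CharP.cast_eq_zero_iff F p N).1 h), ?_⟩
  have hg : (Polynomial.aeval (LinearMap.mulLeft F (t : CliffordAlgebra Q)))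
      ((Polynomial.X ^ N - 1 : Polynomial F) ^ (p ^ a)) = 0 := by
    rw [sub_pow_expChar_pow, one_pow, ← pow_mul, mul_comm N]
    simp only [map_sub, map_pow, Polynomial.aeval_X, map_one]
    rw [sub_eq_zero]
    ext x
    rw [LinearMap.pow_mulLeft, ← Units.val_pow_eq_pow_val, hK]
    simp
  have h3 : (Polynomial.aeval (LinearMap.mulLeft F (t : CliffordAlgebra Q)))
      (Polynomial.X ^ N - 1 : Polynomial F) = 0 := by
    rw [← RingHom.mem_ker, ← Module.AEval.annihilator_eq_ker_aeval (M := CliffordAlgebra Q)] at hg ⊢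
    have hss' : IsSemisimpleModule (Polynomial F) (Module.AEval' (LinearMap.mulLeft F (t : CliffordAlgebra Q))) := hss
    have hrad := IsSemisimpleModule.annihilator_isRadical (Module.AEval' (LinearMap.mulLeft F (t : CliffordAlgebra Q))) (Polynomial F)
    exact hrad ⟨_, hg⟩
  have h4 : t ^ N = 1 := by
    simp only [map_sub, map_pow, Polynomial.aeval_X, map_one] at h3
    rw [sub_eq_zero, LinearMap.pow_mulLeft] at h3
    ext
    have := LinearMap.congr_fun h3 1
    simpa using this
  ext v
  apply iota_inj hF2 Q hQ
  have := act_pow Q T t hT N v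
  rw [h4] at this
  simpa using this.symm

end Part2

section Part3

open QuadraticMap

section Kfield

variable {F K : Type*} [Field F] [Field K] [Algebra F K] [FiniteDimensional F K]

/-- The scaled trace-like form. -/
def bfK (lam : K →ₗ[F] F) (k : K) : LinearMap.BilinForm F K :=
  LinearMap.mk₂ F (fun x y => lam (k * (x * y)))
    (fun x y z => by rw [← map_add]; congr 1; ring)
    (fun c x y => by rw [← map_smul]; congr 1; simp)
    (fun x y z => by rw [← map_add]; congr 1; ring)
    (fun c x y => by rw [← map_smul]; congr 1; simp)

theorem bfK_apply (lam : K →ₗ[F] F) (k x y : K) : bfK lam k x y = lam (k * (x * y)) := rfl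

theorem obK (hF2 : (2 : F) ≠ 0) (lam : K →ₗ[F] F) (hlam : ∃ z, lam z ≠ 0) (k : K) (hk : k ≠ 0) :
    ∃ b : Module.Basis (Fin (Module.finrank F K)) F K, (∀ i j, i ≠ j → lam (k * (b i * b j)) = 0) ∧
      ∀ i, lam (k * (b i * b i)) ≠ 0 := by
  have : Invertible (2 : F) := invertibleOfNonzero hF2
  obtain ⟨b, hb⟩ := LinearMap.BilinForm.exists_orthogonal_basis (B := bfK lam k)
    ⟨fun x y => by simp only [bfK_apply, RingHom.id_apply, mul_comm x y]⟩
  have hb' : ∀ i j, i ≠ j → lam (k * (b i * b j)) = 0 := fun i j hij => hb hij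
  refine ⟨b, hb', fun i h0 => ?_⟩
  obtain ⟨z, hz⟩ := hlam
  have h1 : bfK lam k (b i) = 0 := by
    apply b.ext
    intro j
    by_cases hij : i = j
    · subst hij; exact h0
    · exact hb' i j hij
  have h2 := LinearMap.congr_fun h1 ((k * b i)⁻¹ * z)
  rw [bfK_apply, ← mul_assoc, ← mul_assoc, mul_inv_cancel₀ (mul_ne_zero hk (b.ne_zero i)), one_mul] at h2
  exact hz h2

theorem discK [Finite F] (hF2 : (2 : F) ≠ 0) (lam : K →ₗ[F] F) (hlam : ∃ z, lam z ≠ 0) (k : K)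
    (hk : k ≠ 0) (c : F) (hc : c ≠ 0) : ∃ μ : K, μ ≠ 0 ∧
    ∃ b : Module.Basis (Fin (Module.finrank F K)) F K,
      (∀ i j, i ≠ j → lam (μ * (k * (b i * b j))) = 0) ∧
      (∀ i, lam (μ * (k * (b i * b i))) ≠ 0) ∧ IsSquare (c * ∏ i, lam (μ * (k * (b i * b i)))) := by
  have : Finite K := Module.finite_of_finite F
  obtain ⟨b0, hb0, hb0'⟩ := obK hF2 lam hlam k hk
  have hD : ∏ i, lam (k * (b0 i * b0 i)) ≠ 0 := Finset.prod_ne_zero_iff.2 fun i _ => hb0' i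
  set D := ∏ i, lam (k * (b0 i * b0 i)) with hDdef
  obtain ⟨μ, hμ⟩ := FiniteField.norm_surjective F K (c * D)
  have hμ0 : μ ≠ 0 := by
    rintro rfl
    rw [Algebra.norm_zero] at hμ
    exact mul_ne_zero hc hD hμ.symm
  obtain ⟨b, hb, hb'⟩ := obK hF2 lam hlam (μ * k) (mul_ne_zero hμ0 hk)
  refine ⟨μ, hμ0, b, fun i j hij => by rw [← mul_assoc]; exact hb i j hij,
    fun i => by rw [← mul_assoc]; exact hb' i, ?_⟩
  have e1 : (LinearMap.BilinForm.toMatrix b0 (bfK lam k)).det = D := by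
    have : LinearMap.BilinForm.toMatrix b0 (bfK lam k) =
        Matrix.diagonal (fun i => lam (k * (b0 i * b0 i))) := by
      ext i j
      rw [LinearMap.BilinForm.toMatrix_apply, bfK_apply, Matrix.diagonal_apply]
      split_ifs with h
      · rw [h]
      · exact hb0 i j h
    rw [this, Matrix.det_diagonal]
  have e2 : (LinearMap.BilinForm.toMatrix b (bfK lam (μ * k))).det = ∏ i, lam (μ * (k * (b i * b i))) := by
    have : LinearMap.BilinForm.toMatrix b (bfK lam (μ * k)) =
        Matrix.diagonal (fun i => lam (μ * (k * (b i * b i)))) := by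
      ext i j
      rw [LinearMap.BilinForm.toMatrix_apply, bfK_apply, Matrix.diagonal_apply]
      split_ifs with h
      · rw [h, mul_assoc]
      · exact hb i j h
    rw [this, Matrix.det_diagonal]
  have e3 : bfK lam (μ * k) = (bfK lam k).compLeft (Algebra.lmul F K μ) := by
    ext x y
    simp only [bfK_apply, LinearMap.BilinForm.compLeft_apply, Algebra.coe_lmul_eq_mul, LinearMap.mul_apply']
    congr 1; ring
  have e4 := LinearMap.BilinForm.toMatrix_mul_basis_toMatrix b0 b (bfK lam (μ * k))
  rw [e3, LinearMap.BilinForm.toMatrix_compLeft, ← e3] at e4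
  have e5 := congrArg Matrix.det e4
  rw [Matrix.det_mul, Matrix.det_mul, Matrix.det_mul, Matrix.det_transpose, Matrix.det_transpose, e1, e2,
    LinearMap.det_toMatrix, ← Algebra.norm_apply, hμ] at e5
  rw [← e5]
  exact ⟨c * D * (b0.toMatrix b).det, by ring⟩

theorem binK [Finite K] (h2 : (2 : K) ≠ 0) (k μ : K) (hk : k ≠ 0) : ∃ a b : K, a * a - b * b * k = μ := by
  have := Fintype.ofFinite K
  obtain ⟨a, b, h⟩ := FiniteField.exists_root_sum_quadratic (R := K)
    (f := Polynomial.X ^ 2 - Polynomial.C μ) (g := Polynomial.C (-k) * Polynomial.X ^ 2)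
    (Polynomial.degree_X_pow_sub_C (by norm_num) _)
    (Polynomial.degree_C_mul_X_pow 2 (neg_ne_zero.2 hk)) (by
      apply FiniteField.odd_card_of_char_ne_two
      intro h
      have := ringChar.Nat.cast_ringChar (R := K)
      rw [h] at this
      exact h2 (by simpa using this))
  refine ⟨a, b, ?_⟩
  simp at h
  linear_combination h

end Kfield

variable {F V : Type*} [Field F] [AddCommGroup V] [Module F V]

theorem RL_fix (Q : QuadraticForm F V) (L : List V) (v : V) (h : ∀ e ∈ L, polar Q e v = 0) :
    RL Q L v = v := by
  induction L with
  | nil => rfl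
  | cons e L ih =>
    rw [RL_cons, Module.End.mul_apply, ih (fun x hx => h x (by simp [hx])), refl'_apply, h e (by simp)]
    simp

theorem RL_neg (Q : QuadraticForm F V) (L : List V) (hL : GoodL Q L) (v : V) (hv : v ∈ L) :
    RL Q L v = -v := by
  induction L with
  | nil => simp at hv
  | cons e L ih =>
    have hp := List.pairwise_cons.1 hL.2
    rw [RL_cons, Module.End.mul_apply]
    rcases List.mem_cons.1 hv with rfl | hv
    · rw [RL_fix Q L v (fun e he => by rw [polar_comm]; exact hp.1 e he), refl'_apply, polar_self]
      have := hL.1 v (by simp)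
      have h2 : (Q v)⁻¹ * (2 • Q v) = 2 := by simp only [nsmul_eq_mul]; push_cast; field_simp
      rw [h2, two_smul]; abel
    · rw [ih ⟨fun x hx => hL.1 x (by simp [hx]), hp.2⟩ hv, map_neg, refl'_apply, hp.1 v hv]
      simp

theorem RL_map {V' : Type*} [AddCommGroup V'] [Module F V'] (Q : QuadraticForm F V)
    (Q' : QuadraticForm F V') (i : V' →ₗ[F] V) (hi : ∀ x, Q (i x) = Q' x) (L : List V') (x : V') :
    RL Q (L.map i) (i x) = i (RL Q' L x) := by
  induction L with
  | nil => rfl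
  | cons e L ih =>
    rw [List.map_cons, RL_cons, RL_cons, Module.End.mul_apply, Module.End.mul_apply, ih, refl'_apply,
      refl'_apply, map_sub, map_smul, hi]
    simp only [polar, ← map_add, hi]

theorem GoodL_map {V' : Type*} [AddCommGroup V'] [Module F V'] (Q : QuadraticForm F V)
    (Q' : QuadraticForm F V') (i : V' →ₗ[F] V) (hi : ∀ x, Q (i x) = Q' x) (L : List V')
    (hL : GoodL Q' L) : GoodL Q (L.map i) := by
  refine ⟨?_, ?_⟩
  · intro e he
    obtain ⟨x, hx, rfl⟩ := List.mem_map.1 he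
    rw [hi]; exact hL.1 x hx
  · rw [List.pairwise_map]
    refine hL.2.imp fun {a b} h => ?_
    simpa only [polar, ← map_add, hi] using h

theorem GoodL_append (Q : QuadraticForm F V) (L M : List V) (hL : GoodL Q L) (hM : GoodL Q M)
    (h : ∀ x ∈ L, ∀ y ∈ M, polar Q x y = 0) : GoodL Q (L ++ M) :=
  ⟨fun e he => (List.mem_append.1 he).elim (hL.1 e) (hM.1 e), List.pairwise_append.2 ⟨hL.2, hM.2, h⟩⟩

theorem GoodL_ofFn (Q : QuadraticForm F V) {d : ℕ} (w : Fin d → V) (h1 : ∀ i, Q (w i) ≠ 0)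
    (h2 : ∀ i j, i ≠ j → polar Q (w i) (w j) = 0) : GoodL Q (List.ofFn w) := by
  refine ⟨?_, ?_⟩
  · intro e he
    obtain ⟨i, rfl⟩ := (List.mem_ofFn' _ _).1 he
    exact h1 i
  · rw [List.pairwise_ofFn]
    exact fun i j hij => h2 i j hij.ne

/-- Data of an embedded field line. -/
structure PD {K : Type*} [Field K] [Algebra F K] (Q : QuadraticForm F V) (T Ti : Module.End F V)
    (e : K →ₗ[F] V) (lam : K →ₗ[F] F) (s : K) : Prop where
  adj : ∀ x y, polar Q (T x) y = polar Q x (Ti y)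
  l : ∀ x, T (Ti x) = x
  r : ∀ x, Ti (T x) = x
  hS : ∀ x, T (e x) + Ti (e x) = e (s * x)
  hlam : ∃ z, lam z ≠ 0
  hpol : ∀ x y, polar Q (e x) (e y) = lam (x * y)
  hort : ∀ x y, polar Q (e x) (T (e y) - Ti (e y)) = 0
  hs : s * s - 4 ≠ 0

variable {K : Type*} [Field K] [Algebra F K] {Q : QuadraticForm F V} {T Ti : Module.End F V}
    {e : K →ₗ[F] V} {lam : K →ₗ[F] F} {s : K}

theorem PD.adj' (h : PD Q T Ti e lam s) (x y : V) : polar Q (Ti x) y = polar Q x (T y) := by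
  rw [polar_comm, ← h.adj, polar_comm]

theorem PD.TT (h : PD Q T Ti e lam s) (x : K) : T (T (e x)) = T (e (s * x)) - e x := by
  rw [← h.hS, map_add, h.l]; abel

theorem PD.Ti_eq (h : PD Q T Ti e lam s) (x : K) : Ti (e x) = e (s * x) - T (e x) := by
  rw [← h.hS]; abel

theorem PD.dd (h : PD Q T Ti e lam s) (x : K) :
    T (T (e x) - Ti (e x)) - Ti (T (e x) - Ti (e x)) = e ((s * s - 4) * x) := by
  have h1 : e ((s * s - 4) * x) = e (s * (s * x)) - (4 : F) • e x := by
    rw [← map_smul, ← map_sub]; congr 1; rw [Algebra.smul_def, map_ofNat]; ring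
  rw [h1]
  simp only [map_sub, h.l, h.r, h.Ti_eq, h.TT]
  module

theorem PD.polTT (h : PD Q T Ti e lam s) (hF2 : (2 : F) ≠ 0) (x y : K) :
    polar Q (e x) (T (e y)) = 2⁻¹ * lam (s * (x * y)) := by
  have h1 := h.hort x y
  rw [h.Ti_eq, polar_sub_right, polar_sub_right, h.hpol] at h1
  have e1 : x * (s * y) = s * (x * y) := by ring
  rw [e1] at h1
  rw [eq_inv_mul_iff_mul_eq₀ hF2]
  linear_combination h1

theorem PD.polddd (h : PD Q T Ti e lam s) (x y : K) :
    polar Q (T (e x) - Ti (e x)) (T (e y) - Ti (e y)) = lam ((4 - s * s) * (x * y)) := by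
  have h1 : polar Q (T (e x) - Ti (e x)) (T (e y) - Ti (e y)) =
      - polar Q (e x) (T (T (e y) - Ti (e y)) - Ti (T (e y) - Ti (e y))) := by
    rw [polar_sub_left, h.adj, h.adj', polar_sub_right (y := T (T (e y) - Ti (e y)))]; ring
  rw [h1, h.dd, h.hpol, ← map_neg]; congr 1; ring

theorem PD.piece (h : PD Q T Ti e lam s) (hF2 : (2 : F) ≠ 0) [FiniteDimensional F K]
    (b : Module.Basis (Fin (Module.finrank F K)) F K)
    (hb : ∀ i j, i ≠ j → lam ((4 - s * s) * (b i * b j)) = 0)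
    (hb' : ∀ i, lam ((4 - s * s) * (b i * b i)) ≠ 0) :
    ∃ L L' : List V, GoodL Q L ∧ GoodL Q L' ∧ L.length = Module.finrank F K ∧
      L'.length = Module.finrank F K ∧
      (∀ w ∈ L, ∃ x y, w = e x + (T (e y) - Ti (e y))) ∧
      (∀ w ∈ L', ∃ x y, w = e x + (T (e y) - Ti (e y))) ∧
      (L.map Q).prod = ∏ i, 2⁻¹ * lam ((4 - s * s) * (b i * b i)) ∧
      ∀ x y, RL Q L' (RL Q L (e x + (T (e y) - Ti (e y)))) = T (e x + (T (e y) - Ti (e y))) := by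
  have hs2 : 2 - s ≠ 0 := by
    intro h0; apply h.hs; linear_combination - (2 + s) * h0
  obtain ⟨b', hb1, hb2⟩ := obK hF2 lam h.hlam (2 - s) hs2
  have hq : ∀ z, Q z = 2⁻¹ * polar Q z z := by
    intro z; rw [polar_self]; simp only [nsmul_eq_mul]; push_cast; field_simp
  have hL : GoodL Q (List.ofFn fun i => T (e (b i)) - Ti (e (b i))) := by
    apply GoodL_ofFn
    · intro i; rw [hq, h.polddd]; exact mul_ne_zero (inv_ne_zero hF2) (hb' i)
    · intro i j hij; rw [h.polddd]; exact hb i j hij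
  have hpm : ∀ x y, polar Q (T (e x) - e x) (T (e y) - e y) = lam ((2 - s) * (x * y)) := by
    intro x y
    have e1 : lam ((2 - s) * (x * y)) = 2 * lam (x * y) - lam (s * (x * y)) := by
      rw [← smul_eq_mul (2 : F), ← map_smul, ← map_sub]; congr 1; rw [Algebra.smul_def, map_ofNat]; ring
    rw [e1]
    simp only [polar_sub_left, polar_sub_right, h.adj, h.r, h.hpol, h.Ti_eq, h.polTT hF2]
    have e2 : x * (s * y) = s * (x * y) := by ring
    rw [e2]; field_simp; ring
  have hpp : ∀ x y, polar Q (T (e x) - e x) (T (e y) + e y) = 0 := by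
    intro x y
    simp only [polar_sub_left, polar_add_right, h.adj, h.r, h.hpol, h.Ti_eq, polar_sub_right, h.polTT hF2]
    have e2 : x * (s * y) = s * (x * y) := by ring
    rw [e2]; field_simp; ring
  have hL' : GoodL Q (List.ofFn fun i => T (e (b' i)) - e (b' i)) := by
    apply GoodL_ofFn
    · intro i; rw [hq, hpm]; exact mul_ne_zero (inv_ne_zero hF2) (hb2 i)
    · intro i j hij; rw [hpm]; exact hb1 i j hij
  have two_d : ∀ x, T (e x) - Ti (e x) = (2 : F) • T (e x) - e (s * x) := by
    intro x; rw [h.Ti_eq, two_smul]; abel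
  refine ⟨_, _, hL, hL', by simp, by simp, ?_, ?_, ?_, ?_⟩
  · intro w hw
    obtain ⟨i, rfl⟩ := (List.mem_ofFn' _ _).1 hw
    exact ⟨0, b i, by simp⟩
  · intro w hw
    obtain ⟨i, rfl⟩ := (List.mem_ofFn' _ _).1 hw
    refine ⟨(2⁻¹ : F) • (s * b' i) - b' i, (2⁻¹ : F) • b' i, ?_⟩
    simp only [map_sub, map_smul]
    have := two_d (b' i)
    rw [← smul_sub, this, smul_sub, smul_smul, inv_mul_cancel₀ hF2]
    module
  · rw [List.map_ofFn, List.prod_ofFn]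
    refine Finset.prod_congr rfl fun i _ => ?_
    rw [Function.comp_apply, hq, h.polddd]
  · set L := List.ofFn fun i => T (e (b i)) - Ti (e (b i)) with hLd
    set L' := List.ofFn fun i => T (e (b' i)) - e (b' i) with hLd'
    have r1 : ∀ x, RL Q L (e x) = e x := by
      intro x
      apply RL_fix
      intro w hw
      obtain ⟨i, rfl⟩ := (List.mem_ofFn' _ _).1 hw
      rw [polar_comm]; exact h.hort _ _
    have r2 : ∀ x, RL Q L (T (e x) - Ti (e x)) = -(T (e x) - Ti (e x)) := by
      intro x
      have : (RL Q L) ∘ₗ ((T - Ti) ∘ₗ e) = - ((T - Ti) ∘ₗ e) := by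
        apply b.ext
        intro i
        exact RL_neg Q L hL _ ((List.mem_ofFn' _ _).2 ⟨i, rfl⟩)
      exact LinearMap.congr_fun this x
    have r3 : ∀ x, RL Q L' (T (e x) - e x) = -(T (e x) - e x) := by
      intro x
      have : (RL Q L') ∘ₗ ((T - 1) ∘ₗ e) = - ((T - 1) ∘ₗ e) := by
        apply b'.ext
        intro i
        exact RL_neg Q L' hL' _ ((List.mem_ofFn' _ _).2 ⟨i, rfl⟩)
      exact LinearMap.congr_fun this x
    have r4 : ∀ x, RL Q L' (T (e x) + e x) = T (e x) + e x := by
      intro x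
      apply RL_fix
      intro w hw
      obtain ⟨i, rfl⟩ := (List.mem_ofFn' _ _).1 hw
      exact hpp _ _
    have r5 : ∀ x, RL Q L' (e x) = T (e x) := by
      intro x
      have e1 : e x = (2⁻¹ : F) • ((T (e x) + e x) - (T (e x) - e x)) := by
        rw [add_sub_sub_cancel, ← two_smul F (e x), smul_smul, inv_mul_cancel₀ hF2, one_smul]
      have e2 : T (e x) = (2⁻¹ : F) • ((T (e x) + e x) + (T (e x) - e x)) := by
        rw [add_add_sub_cancel, ← two_smul F (T (e x)), smul_smul, inv_mul_cancel₀ hF2, one_smul]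
      conv_lhs => rw [e1]
      rw [map_smul, map_sub, r3, r4, sub_neg_eq_add, ← e2]
    have r6 : ∀ x, RL Q L' (T (e x)) = e x := by
      intro x
      have := r4 x
      rw [map_add, r5] at this
      exact add_right_cancel (this.trans (add_comm _ _))
    intro x y
    rw [map_add, r1, r2, map_add, r5, map_neg, two_d, map_sub, map_smul, r5, r6, map_add, map_sub,
      map_smul, h.TT]
    module

end Part3

section Part4

open QuadraticMap Polynomial

variable {F V : Type*} [Field F] [AddCommGroup V] [Module F V]

section twist

variable {K : Type*} [Field K] [Algebra F K] {Q : QuadraticForm F V} {T Ti : Module.End F V}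
    {e : K →ₗ[F] V} {lam : K →ₗ[F] F} {s : K}

theorem PD.twist (h : PD Q T Ti e lam s) (a b μ : K) (hμ : μ ≠ 0)
    (hab : a * a - b * b * (s * s - 4) = μ) :
    PD Q T Ti (e ∘ₗ LinearMap.mulLeft F a + (T - Ti) ∘ₗ e ∘ₗ LinearMap.mulLeft F b)
      (lam ∘ₗ LinearMap.mulLeft F μ) s := by
  have hd : ∀ x, T (T (e x) - Ti (e x)) + Ti (T (e x) - Ti (e x)) = T (e (s * x)) - Ti (e (s * x)) := by
    intro x
    rw [← h.hS]
    simp only [map_sub, map_add, h.l, h.r]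
    abel
  have hort' : ∀ x y, polar Q (T (e x) - Ti (e x)) (e y) = 0 := by
    intro x y; rw [polar_comm]; exact h.hort _ _
  refine ⟨h.adj, h.l, h.r, ?_, ?_, ?_, ?_, h.hs⟩
  · intro x
    simp only [LinearMap.add_apply, LinearMap.comp_apply, LinearMap.mulLeft_apply, LinearMap.sub_apply]
    have e1 : e (a * (s * x)) = T (e (a * x)) + Ti (e (a * x)) := by rw [h.hS]; congr 1; ring
    have e2 := hd (b * x)
    have e3 : b * (s * x) = s * (b * x) := by ring
    rw [e1, e3, ← e2, map_add, map_add]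
    abel
  · obtain ⟨z, hz⟩ := h.hlam
    refine ⟨μ⁻¹ * z, ?_⟩
    simp only [LinearMap.comp_apply, LinearMap.mulLeft_apply]
    rwa [mul_inv_cancel_left₀ hμ]
  · intro x y
    simp only [LinearMap.add_apply, LinearMap.comp_apply, LinearMap.mulLeft_apply, LinearMap.sub_apply]
    rw [polar_add_left, polar_add_right, polar_add_right, h.hpol, h.hort, hort', h.polddd, add_zero,
      zero_add, ← map_add, ← hab]
    congr 1; ring
  · intro x y
    simp only [LinearMap.add_apply, LinearMap.comp_apply, LinearMap.mulLeft_apply, LinearMap.sub_apply]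
    have e1 : T (e (a * y) + (T (e (b * y)) - Ti (e (b * y)))) - Ti (e (a * y) + (T (e (b * y)) - Ti (e (b * y))))
      = (T (e (a * y)) - Ti (e (a * y))) + e ((s * s - 4) * (b * y)) := by
      rw [← h.dd, map_add, map_add]; abel
    rw [e1, polar_add_left, polar_add_right, polar_add_right, h.hpol, h.hort, hort', h.polddd, add_zero,
      zero_add, ← map_add, ← map_zero lam]
    congr 1; ring

theorem PD.full [Finite F] [FiniteDimensional F K] (h : PD Q T Ti e lam s) (hF2 : (2 : F) ≠ 0)
    (c : F) (hc : c ≠ 0) :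
    ∃ (U : Submodule F V) (L L' : List V), GoodL Q L ∧ GoodL Q L' ∧ L.length = Module.finrank F K ∧
      L'.length = Module.finrank F K ∧ (∀ w ∈ L, w ∈ U) ∧ (∀ w ∈ L', w ∈ U) ∧
      IsSquare (c * (L.map Q).prod) ∧ (∀ u ∈ U, RL Q L' (RL Q L u) = T u) ∧
      (∀ u ∈ U, T u ∈ U) ∧ (∀ u ∈ U, Ti u ∈ U) ∧ (∀ u ∈ U, (∀ w ∈ U, polar Q u w = 0) → u = 0) ∧
      Module.finrank F U = 2 * Module.finrank F K := by
  have hFK : Finite K := Module.finite_of_finite F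
  have h4 : 4 - s * s ≠ 0 := by intro h0; exact h.hs (by linear_combination - h0)
  have hc' : c * (2⁻¹ : F) ^ (Module.finrank F K) ≠ 0 := mul_ne_zero hc (pow_ne_zero _ (inv_ne_zero hF2))
  obtain ⟨μ, hμ, b, hb, hb', hsq⟩ := discK hF2 lam h.hlam (4 - s * s) h4 _ hc'
  have h2K : (2 : K) ≠ 0 := by
    have := (map_ne_zero (algebraMap F K)).2 hF2
    rwa [map_ofNat] at this
  obtain ⟨a, b₁, hab⟩ := binK h2K (s * s - 4) μ h.hs
  have h' := h.twist a b₁ μ hμ hab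
  set e' := e ∘ₗ LinearMap.mulLeft F a + (T - Ti) ∘ₗ e ∘ₗ LinearMap.mulLeft F b₁ with he'
  set lam' := lam ∘ₗ LinearMap.mulLeft F μ with hlam'
  clear_value e'
  obtain ⟨L, L', hL, hL', hl, hl', hU, hU', hp, hR⟩ := h'.piece hF2 b hb hb'
  have hort' : ∀ x y, polar Q (T (e' x) - Ti (e' x)) (e' y) = 0 := by
    intro x y; rw [polar_comm]; exact h'.hort _ _
  have hnd : ∀ x y, (∀ x' y', polar Q (e' x + (T (e' y) - Ti (e' y)))
      (e' x' + (T (e' y') - Ti (e' y'))) = 0) → x = 0 ∧ y = 0 := by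
    intro x y hxy
    obtain ⟨z, hz⟩ := h'.hlam
    constructor
    · by_contra hx
      have := hxy (x⁻¹ * z) 0
      rw [map_zero, map_zero, map_zero, sub_zero, add_zero, polar_add_left, h'.hpol, hort', add_zero,
        mul_inv_cancel_left₀ hx] at this
      exact hz this
    · by_contra hx
      have := hxy 0 ((4 - s * s)⁻¹ * (y⁻¹ * z))
      rw [map_zero, zero_add, polar_add_left, h'.hort, h'.polddd, zero_add] at this
      apply hz
      rw [← this]; congr 1
      generalize 4 - s * s = k at h4
      field_simp
  have hmem : ∀ u, u ∈ LinearMap.range (e'.coprod ((T - Ti) ∘ₗ e')) ↔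
      ∃ x y, u = e' x + (T (e' y) - Ti (e' y)) := by
    intro u
    constructor
    · rintro ⟨⟨x, y⟩, rfl⟩
      exact ⟨x, y, rfl⟩
    · rintro ⟨x, y, rfl⟩
      exact ⟨⟨x, y⟩, rfl⟩
  have hTst : ∀ x, ∃ x' y', T (e' x) = e' x' + (T (e' y') - Ti (e' y')) := by
    intro x
    refine ⟨(2⁻¹ : F) • (s * x), (2⁻¹ : F) • x, ?_⟩
    simp only [map_smul]
    rw [← smul_sub, ← smul_add, ← h'.hS]
    rw [show T (e' x) + Ti (e' x) + (T (e' x) - Ti (e' x)) = (2 : F) • T (e' x) by rw [two_smul]; abel,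
      smul_smul, inv_mul_cancel₀ hF2, one_smul]
  set U := LinearMap.range (e'.coprod ((T - Ti) ∘ₗ e')) with hUd
  have heU : ∀ x, e' x ∈ U := fun x => (hmem _).2 ⟨x, 0, by simp⟩
  have hTe : ∀ x, T (e' x) ∈ U := fun x => (hmem _).2 (hTst x)
  have hTie : ∀ x, Ti (e' x) ∈ U := fun x => by rw [h'.Ti_eq]; exact U.sub_mem (heU _) (hTe _)
  have hTTe : ∀ x, T (T (e' x)) ∈ U := fun x => by rw [h'.TT]; exact U.sub_mem (hTe _) (heU _)
  refine ⟨U, L, L', hL, hL', hl, hl', fun w hw => (hmem w).2 (hU w hw),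
    fun w hw => (hmem w).2 (hU' w hw), ?_, ?_, ?_, ?_, ?_, ?_⟩
  · rw [hp, Finset.prod_mul_distrib, Finset.prod_const, Finset.card_univ, Fintype.card_fin, ← mul_assoc]
    exact hsq
  · intro u hu
    obtain ⟨x, y, rfl⟩ := (hmem u).1 hu
    exact hR x y
  · intro u hu
    obtain ⟨x, y, rfl⟩ := (hmem u).1 hu
    rw [map_add, map_sub, h'.l]
    exact U.add_mem (hTe _) (U.sub_mem (hTTe _) (heU _))
  · intro u hu
    obtain ⟨x, y, rfl⟩ := (hmem u).1 hu
    rw [map_add, map_sub, h'.r, h'.Ti_eq y, map_sub]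
    refine U.add_mem (hTie _) (U.sub_mem (heU _) (U.sub_mem (hTie _) ?_))
    rw [h'.r]; exact heU _
  · intro u hu hw
    obtain ⟨x, y, rfl⟩ := (hmem u).1 hu
    obtain ⟨rfl, rfl⟩ := hnd x y fun x' y' => hw _ ((hmem _).2 ⟨x', y', rfl⟩)
    simp
  · rw [hUd, LinearMap.finrank_range_of_inj, Module.finrank_prod]
    · ring
    · rw [← LinearMap.ker_eq_bot, LinearMap.ker_eq_bot']
      rintro ⟨x, y⟩ h0
      have h0' : e' x + (T (e' y) - Ti (e' y)) = 0 := h0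
      obtain ⟨rfl, rfl⟩ := hnd x y fun x' y' => by rw [h0', polar_zero_left]
      rfl

end twist

/-- Orthogonal operator with inverse. -/
structure IT (Q : QuadraticForm F V) (T Ti : Module.End F V) : Prop where
  adj : ∀ x y, polar Q (T x) y = polar Q x (Ti y)
  l : ∀ x, T (Ti x) = x
  r : ∀ x, Ti (T x) = x

theorem IT.adj' {Q : QuadraticForm F V} {T Ti : Module.End F V} (h : IT Q T Ti) (x y : V) :
    polar Q (Ti x) y = polar Q x (T y) := by
  rw [polar_comm, ← h.adj, polar_comm]

theorem IT.selfadj {Q : QuadraticForm F V} {T Ti : Module.End F V} (h : IT Q T Ti) (p : F[X]) (x y : V) :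
    polar Q (aeval (T + Ti) p x) y = polar Q x (aeval (T + Ti) p y) := by
  induction p using Polynomial.induction_on' generalizing x y with
  | add p q hp hq =>
    rw [map_add, LinearMap.add_apply, LinearMap.add_apply, polar_add_left, polar_add_right, hp, hq]
  | monomial n a =>
    rw [aeval_monomial]
    simp only [Module.End.mul_apply, Module.algebraMap_end_apply]
    rw [polar_smul_left, polar_smul_right]
    congr 1
    induction n generalizing x y with
    | zero => simp
    | succ n ih =>
      rw [pow_succ, Module.End.mul_apply, ih, ← pow_succ, pow_succ', Module.End.mul_apply, LinearMap.add_apply,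
        LinearMap.add_apply, polar_add_left, polar_add_right, h.adj, h.adj']
      ring

theorem IT.commS {Q : QuadraticForm F V} {T Ti : Module.End F V} (h : IT Q T Ti) (p : F[X]) (x : V) :
    aeval (T + Ti) p (T x - Ti x) = T (aeval (T + Ti) p x) - Ti (aeval (T + Ti) p x) := by
  have h1 : Commute (T + Ti) (T - Ti) := by
    have : T * Ti = Ti * T := by ext x; simp [h.l, h.r]
    rw [commute_iff_eq, add_mul, mul_sub, mul_sub, sub_mul, mul_add, mul_add, this]; abel
  have h2 : Commute (aeval (T + Ti) p) (T - Ti) := by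
    induction p using Polynomial.induction_on' with
    | add p q hp hq => rw [map_add]; exact hp.add_left hq
    | monomial n a => rw [aeval_monomial]; exact (Algebra.commute_algebraMap_left a _).mul_left (h1.pow_left n)
  exact LinearMap.congr_fun h2.eq x

theorem PD_exists (hF2 : (2 : F) ≠ 0) {Q : QuadraticForm F V} {T Ti : Module.End F V} (h : IT Q T Ti)
    (hinj : ∀ x, T (T x) = x → x = 0)
    (f : F[X]) (hf : f.Monic) [Fact (Irreducible f)] (v : V) (hv : aeval (T + Ti) f v = 0) (hQv : Q v ≠ 0) :
    ∃ (e : AdjoinRoot f →ₗ[F] V) (lam : AdjoinRoot f →ₗ[F] F), PD Q T Ti e lam (AdjoinRoot.root f) := by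
  set S := T + Ti with hSd
  set e : AdjoinRoot f →ₗ[F] V := (LinearMap.applyₗ v) ∘ₗ (aeval S).toLinearMap ∘ₗ AdjoinRoot.modByMonicHom hf with he
  have hmk : ∀ g, e (AdjoinRoot.mk f g) = aeval S g v := by
    intro g
    have : e (AdjoinRoot.mk f g) = aeval S (g %ₘ f) v := by
      simp [he, AdjoinRoot.modByMonicHom_mk]
    rw [this]
    conv_rhs => rw [← modByMonic_add_div g f, mul_comm, map_add, map_mul, LinearMap.add_apply, Module.End.mul_apply, hv]
    simp
  clear_value e
  have hS : ∀ x, T (e x) + Ti (e x) = e (AdjoinRoot.root f * x) := by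
    intro x
    obtain ⟨g, rfl⟩ := AdjoinRoot.mk_surjective x
    rw [← AdjoinRoot.mk_X, ← map_mul, hmk, hmk, map_mul, aeval_X]; rfl
  have hpol0 : ∀ x y, polar Q (e x) (e y) = polar Q (e (x * y)) v := by
    intro x y
    obtain ⟨g, rfl⟩ := AdjoinRoot.mk_surjective x
    obtain ⟨g', rfl⟩ := AdjoinRoot.mk_surjective y
    rw [← map_mul, hmk, hmk, hmk, mul_comm, map_mul, Module.End.mul_apply, ← h.selfadj g', polar_comm]
  have h1 : e 1 = v := by rw [← map_one (AdjoinRoot.mk f), hmk]; simp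
  refine ⟨e, (polarBilin Q).flip v ∘ₗ e, h.adj, h.l, h.r, hS, ⟨1, ?_⟩, hpol0, ?_, ?_⟩
  · rw [LinearMap.comp_apply, h1]
    show polar Q v v ≠ 0
    rw [polar_self]; simpa using ⟨hF2, hQv⟩
  · intro x y
    have h0 : ∀ z, polar Q v (T (e z) - Ti (e z)) = 0 := by
      intro z
      obtain ⟨g, rfl⟩ := AdjoinRoot.mk_surjective z
      have e1 : polar Q v (T (aeval S g v) - Ti (aeval S g v)) =
          - polar Q v (T (aeval S g v) - Ti (aeval S g v)) := by
        conv_lhs => rw [← h.commS, ← h.selfadj, polar_sub_right, ← h.adj, ← h.adj', polar_comm Q (Ti _), polar_comm Q (T _), ← polar_sub_right, ← neg_sub, polar_neg_right]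
      rw [hmk]
      have e2 : (2 : F) * polar Q v (T (aeval S g v) - Ti (aeval S g v)) = 0 := by
        rw [two_mul]; nth_rewrite 1 [e1]; ring
      exact (mul_eq_zero.1 e2).resolve_left hF2
    obtain ⟨g, rfl⟩ := AdjoinRoot.mk_surjective x
    rw [hmk, h.selfadj, h.commS]
    obtain ⟨g', rfl⟩ := AdjoinRoot.mk_surjective y
    have e3 : aeval S g (e (AdjoinRoot.mk f g')) = e (AdjoinRoot.mk f (g * g')) := by
      rw [hmk, hmk, map_mul]; rfl
    rw [← hSd, e3]
    exact h0 _
  · intro h0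
    have e1 : e (AdjoinRoot.root f * (AdjoinRoot.root f * 1)) - (4 : F) • e 1 = 0 := by
      rw [← map_smul, ← map_sub, Algebra.smul_def, map_ofNat, ← mul_assoc, ← sub_mul, h0, zero_mul, map_zero]
    rw [← hS, ← hS, h1] at e1
    simp only [map_add, h.l, h.r] at e1
    have e2 : T (T v) - v = 0 := by
      apply hinj
      have e3 := congrArg T (congrArg T e1)
      simp only [map_sub, map_add, map_smul, h.l, map_zero] at e3
      rw [map_sub, map_sub, ← sub_eq_zero, ← e3]
      module
    have e4 : v = 0 := hinj v (sub_eq_zero.1 e2)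
    exact hQv (by rw [e4, map_zero])

end Part4

section Part5

open QuadraticMap Polynomial

universe u

theorem exists_vec {F V : Type*} [Field F] [AddCommGroup V] [Module F V]
    {Q : QuadraticForm F V} {T Ti : Module.End F V} (h : IT Q T Ti) (n : ℕ) :
    ∀ (m : F[X]) (v : V), m.natDegree = n → Squarefree m → aeval (T + Ti) m v = 0 → Q v ≠ 0 →
      ∃ (f : F[X]) (w : V), f.Monic ∧ Irreducible f ∧ aeval (T + Ti) f w = 0 ∧ Q w ≠ 0 := by
  induction n using Nat.strong_induction_on with
  | _ n ih =>
    intro m v hn hm hv hQ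
    have hm0 : m ≠ 0 := hm.ne_zero
    by_cases hirr : Irreducible m
    · refine ⟨m * C m.leadingCoeff⁻¹, v, monic_mul_leadingCoeff_inv hm0, ?_, ?_, hQ⟩
      · rw [irreducible_mul_leadingCoeff_inv]; exact hirr
      · rw [mul_comm, map_mul, Module.End.mul_apply, hv, map_zero]
    · have hnu : ¬ IsUnit m := by
        intro hu
        obtain ⟨c, hc, rfl⟩ := Polynomial.isUnit_iff.1 hu
        rw [aeval_C, Module.algebraMap_end_apply] at hv
        rw [(smul_eq_zero.1 hv).resolve_left hc.ne_zero, map_zero] at hQ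
        exact hQ rfl
      rw [irreducible_iff] at hirr
      push Not at hirr
      obtain ⟨f, g, rfl, hf, hg⟩ := hirr hnu
      obtain ⟨hco, hf', hg'⟩ := squarefree_mul_iff.1 hm
      have hfd := natDegree_pos_iff_degree_pos.2 (degree_pos_of_ne_zero_of_nonunit hf'.ne_zero hf)
      have hgd := natDegree_pos_iff_degree_pos.2 (degree_pos_of_ne_zero_of_nonunit hg'.ne_zero hg)
      rw [natDegree_mul hf'.ne_zero hg'.ne_zero] at hn
      obtain ⟨a, b, hab⟩ := hco.isCoprime
      have hdec : v = aeval (T + Ti) (a * f) v + aeval (T + Ti) (b * g) v := by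
        rw [← LinearMap.add_apply, ← map_add, hab]; simp
      have h1 : aeval (T + Ti) g (aeval (T + Ti) (a * f) v) = 0 := by
        rw [← Module.End.mul_apply, ← map_mul, show g * (a * f) = a * (f * g) by ring, map_mul,
          Module.End.mul_apply, hv, map_zero]
      have h2 : aeval (T + Ti) f (aeval (T + Ti) (b * g) v) = 0 := by
        rw [← Module.End.mul_apply, ← map_mul, show f * (b * g) = b * (f * g) by ring, map_mul,
          Module.End.mul_apply, hv, map_zero]
      have h3 : polar Q (aeval (T + Ti) (a * f) v) (aeval (T + Ti) (b * g) v) = 0 := by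
        rw [h.selfadj, map_mul _ a f, Module.End.mul_apply, h2, map_zero, polar_zero_right]
      by_cases hQ1 : Q (aeval (T + Ti) (a * f) v) = 0
      · refine ih f.natDegree (by omega) f _ rfl hf' h2 fun hQ2 => hQ ?_
        rw [polar, ← hdec, hQ1, hQ2] at h3
        simpa using h3
      · exact ih g.natDegree (by omega) g _ rfl hg' h1 hQ1

theorem aeval_inter {F V W : Type*} [Field F] [AddCommGroup V] [Module F V] [AddCommGroup W] [Module F W]
    (S : Module.End F V) (S' : Module.End F W) (i : W →ₗ[F] V) (hi : ∀ x, i (S' x) = S (i x))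
    (p : F[X]) (x : W) : i (aeval S' p x) = aeval S p (i x) := by
  induction p using Polynomial.induction_on' with
  | add p q hp hq => simp [hp, hq]
  | monomial n a =>
    rw [aeval_monomial, aeval_monomial]
    simp only [Module.End.mul_apply, Module.algebraMap_end_apply, map_smul]
    congr 1
    induction n with
    | zero => simp
    | succ n ih => rw [pow_succ', pow_succ', Module.End.mul_apply, Module.End.mul_apply, hi, ih]

theorem RL_mem {F V : Type*} [Field F] [AddCommGroup V] [Module F V] (Q : QuadraticForm F V) (L : List V)
    (U : Submodule F V) (hL : ∀ e ∈ L, e ∈ U) (u : V) (hu : u ∈ U) : RL Q L u ∈ U := by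
  induction L with
  | nil => exact hu
  | cons e L ih =>
    rw [RL_cons, Module.End.mul_apply, refl'_apply]
    exact U.sub_mem (ih fun x hx => hL x (by simp [hx])) (U.smul_mem _ (hL e (by simp)))

/-- Elementwise nondegeneracy. -/
def ND {F V : Type*} [Field F] [AddCommGroup V] [Module F V] (Q : QuadraticForm F V) : Prop :=
  ∀ x, (∀ y, polar Q x y = 0) → x = 0

theorem orth_compl {F V : Type*} [Field F] [AddCommGroup V] [Module F V] [FiniteDimensional F V]
    (Q : QuadraticForm F V) (U : Submodule F V)
    (hU : ∀ u ∈ U, (∀ w ∈ U, polar Q u w = 0) → u = 0) :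
    ∃ W : Submodule F V, (∀ w, w ∈ W ↔ ∀ u ∈ U, polar Q u w = 0) ∧ IsCompl U W := by
  refine ⟨LinearMap.BilinForm.orthogonal (polarBilin Q) U, fun w => Iff.rfl, ?_⟩
  have hr : LinearMap.BilinForm.IsRefl (polarBilin Q) := fun x y hxy => by
    rw [polarBilin_apply_apply, polar_comm]; exact hxy
  rw [LinearMap.BilinForm.isCompl_orthogonal_iff_disjoint hr, Submodule.disjoint_def]
  intro x hx hx'
  exact hU x hx fun w hw => by rw [polar_comm]; exact hx' w hw

theorem Ind {F : Type*} [Field F] [Finite F] (hF2 : (2 : F) ≠ 0) (n : ℕ) :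
    ∀ (V : Type u) [AddCommGroup V] [Module F V] [FiniteDimensional F V] (Q : QuadraticForm F V)
      (T Ti : Module.End F V), Module.finrank F V = n → IT Q T Ti → (∀ x, T (T x) = x → x = 0) → ND Q →
      ∀ m : F[X], Squarefree m → (∀ x, aeval (T + Ti) m x = 0) → ∀ c : F, c ≠ 0 →
      ∃ L L' : List V, GoodL Q L ∧ GoodL Q L' ∧ n = 2 * L.length ∧ n = 2 * L'.length ∧
        (∀ v, RL Q L' (RL Q L v) = T v) ∧ (0 < n → IsSquare (c * (L.map Q).prod)) := by
  induction n using Nat.strong_induction_on with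
  | _ n ih =>
    intro V _ _ _ Q T Ti hn h hinj hnd m hm hmS c hc
    rcases Nat.eq_zero_or_pos n with h0 | hpos
    · subst h0
      have := Module.finrank_zero_iff.1 hn
      exact ⟨[], [], ⟨by simp, by simp⟩, ⟨by simp, by simp⟩, by simp, by simp,
        fun v => Subsingleton.elim _ _, by simp⟩
    obtain ⟨v, hv⟩ : ∃ v, Q v ≠ 0 := by
      by_contra! hall
      have : Subsingleton V := by
        refine subsingleton_of_forall_eq 0 fun x => hnd x fun y => ?_
        simp [polar, hall]
      rw [Module.finrank_zero_iff.2 this] at hn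
      omega
    obtain ⟨f, w, hf, hirr, hfw, hQw⟩ := exists_vec h _ m v rfl hm (hmS v) hv
    have : Fact (Irreducible f) := ⟨hirr⟩
    obtain ⟨e, lam, hPD⟩ := PD_exists hF2 h hinj f hf w hfw hQw
    have : FiniteDimensional F (AdjoinRoot f) := (AdjoinRoot.powerBasis hf.ne_zero).finite
    obtain ⟨U, L, L', hL, hL', hl, hl', hLU, hLU', hsq, hR, hUT, hUTi, hUnd, hUfr⟩ := hPD.full hF2 c hc
    have hd : 0 < Module.finrank F (AdjoinRoot f) := Module.finrank_pos
    obtain ⟨W, hW, hcompl⟩ := orth_compl Q U hUnd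
    have hfr := Submodule.finrank_add_eq_of_isCompl hcompl
    have hWT : ∀ w ∈ W, T w ∈ W := by
      intro w hw
      rw [hW] at hw ⊢
      intro u hu
      rw [← h.adj']; exact hw _ (hUTi u hu)
    have hWTi : ∀ w ∈ W, Ti w ∈ W := by
      intro w hw
      rw [hW] at hw ⊢
      intro u hu
      rw [← h.adj]; exact hw _ (hUT u hu)
    have hUW : ∀ u ∈ U, ∀ w ∈ W, polar Q u w = 0 := fun u hu w hw => (hW w).1 hw u hu
    have hdec : ∀ x : V, ∃ u ∈ U, ∃ w ∈ W, x = u + w := by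
      intro x
      have : x ∈ U ⊔ W := by rw [hcompl.sup_eq_top]; trivial
      obtain ⟨u, hu, w, hw, rfl⟩ := Submodule.mem_sup.1 this
      exact ⟨u, hu, w, hw, rfl⟩
    obtain ⟨M, M', hM, hM', hm1, hm1', hRM, hMsq⟩ := ih (Module.finrank F W) (by omega) W
      (Q.comp W.subtype) (T.restrict hWT) (Ti.restrict hWTi) rfl
      ⟨fun x y => h.adj x y, fun x => Subtype.ext (h.l x), fun x => Subtype.ext (h.r x)⟩
      (fun x hx => Subtype.ext (hinj x (congrArg Subtype.val hx)))
      (fun x hx => by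
        refine Subtype.ext (hnd x fun y => ?_)
        obtain ⟨u, hu, w, hw, rfl⟩ := hdec y
        rw [polar_add_right, polar_comm Q _ u, hUW u hu _ x.2, zero_add]
        exact hx ⟨w, hw⟩) m hm
      (fun x => by
        apply Subtype.ext
        have := aeval_inter (T + Ti) (T.restrict hWT + Ti.restrict hWTi) W.subtype (fun x => rfl) m x
        exact this.trans (hmS _)) 1 one_ne_zero
    have hsub : ∀ x : W, Q (W.subtype x) = (Q.comp W.subtype) x := fun x => rfl
    have hMW : ∀ (N : List W), ∀ x ∈ N.map W.subtype, x ∈ W := by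
      intro N x hx
      obtain ⟨y, _, rfl⟩ := List.mem_map.1 hx
      exact y.2
    refine ⟨L ++ M.map W.subtype, L' ++ M'.map W.subtype,
      GoodL_append Q _ _ hL (GoodL_map Q _ _ hsub _ hM) (fun x hx y hy => hUW x (hLU x hx) y (hMW _ y hy)),
      GoodL_append Q _ _ hL' (GoodL_map Q _ _ hsub _ hM') (fun x hx y hy => hUW x (hLU' x hx) y (hMW _ y hy)),
      ?_, ?_, ?_, ?_⟩
    · rw [List.length_append, List.length_map]; omega
    · rw [List.length_append, List.length_map]; omega
    · intro x
      obtain ⟨u, hu, w, hw, rfl⟩ := hdec x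
      have fixU : ∀ N : List W, ∀ u ∈ U, RL Q (N.map W.subtype) u = u := fun N u hu =>
        RL_fix _ _ _ fun e he => by rw [polar_comm]; exact hUW _ hu _ (hMW _ e he)
      have hLu : RL Q L u ∈ U := RL_mem Q L U hLU u hu
      have fixL : ∀ w ∈ W, RL Q L w = w := fun w hw => RL_fix _ _ _ fun e he => hUW _ (hLU _ he) _ hw
      have fixL' : ∀ w ∈ W, RL Q L' w = w := fun w hw => RL_fix _ _ _ fun e he => hUW _ (hLU' _ he) _ hw
      have hMw : ∀ (N : List W) (w : W), RL Q (N.map W.subtype) w = RL (Q.comp W.subtype) N w :=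
        fun N w => RL_map Q _ _ hsub N w
      simp only [RL_append, Module.End.mul_apply, map_add]
      rw [fixU M u hu, fixU M' _ hLu, hR u hu, hMw M ⟨w, hw⟩, fixL _ (Subtype.property _), hMw,
        fixL' _ (Subtype.property _), hRM]
      rfl
    · intro _
      have hM2 : IsSquare (M.map (Q.comp W.subtype)).prod := by
        rcases Nat.eq_zero_or_pos (Module.finrank F W) with h0 | hp
        · have : M = [] := List.length_eq_zero_iff.1 (by omega)
          rw [this]; simp
        · simpa using hMsq hp
      rw [List.map_append, List.prod_append, ← mul_assoc, List.map_map]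
      exact hsq.mul hM2

end Part5

section Part6

open QuadraticMap Polynomial

variable {F V : Type*} [Field F] [AddCommGroup V] [Module F V]

theorem RL_neg_span (Q : QuadraticForm F V) (L : List V) (hL : GoodL Q L) (v : V)
    (hv : v ∈ Submodule.span F {x | x ∈ L}) : RL Q L v = -v := by
  induction hv using Submodule.span_induction with
  | mem x hx => exact RL_neg Q L hL x hx
  | zero => simp
  | add x y _ _ hx hy => rw [map_add, hx, hy]; abel
  | smul a x _ hx => rw [map_smul, hx, smul_neg]

theorem ob_list [FiniteDimensional F V] (hF2 : (2 : F) ≠ 0) (Q : QuadraticForm F V) (U : Submodule F V)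
    (hU : ∀ u ∈ U, (∀ w ∈ U, polar Q u w = 0) → u = 0) :
    ∃ B : List V, GoodL Q B ∧ (∀ x ∈ B, x ∈ U) ∧ B.length = Module.finrank F U ∧
      U ≤ Submodule.span F {x | x ∈ B} := by
  have : Invertible (2 : F) := invertibleOfNonzero hF2
  obtain ⟨b, hb⟩ := LinearMap.BilinForm.exists_orthogonal_basis (B := polarBilin (Q.comp U.subtype))
    ⟨fun x y => by simp only [polarBilin_apply_apply, RingHom.id_apply]; exact polar_comm _ _ _⟩
  have hb' : ∀ i j, i ≠ j → polar Q (b i : V) (b j) = 0 := fun i j hij => hb hij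
  refine ⟨List.ofFn fun i => (b i : V), GoodL_ofFn Q _ ?_ hb', ?_, by simp, ?_⟩
  · intro i h0
    have h1 : polarBilin (Q.comp U.subtype) (b i) = 0 := by
      apply b.ext
      intro j
      by_cases hij : i = j
      · subst hij
        show polar Q (b i : V) (b i) = 0
        rw [polar_self, h0, smul_zero]
      · exact hb' i j hij
    have h2 := hU (b i) (b i).2 fun w hw => LinearMap.congr_fun h1 ⟨w, hw⟩
    exact b.ne_zero i (Subtype.ext h2)
  · intro x hx
    obtain ⟨i, rfl⟩ := (List.mem_ofFn' _ _).1 hx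
    exact (b i).2
  · intro u hu
    have h1 : (⟨u, hu⟩ : U) ∈ Submodule.span F (Set.range b) := by rw [b.span_eq]; trivial
    have h2 := Submodule.mem_map_of_mem (f := U.subtype) h1
    rw [Submodule.map_span] at h2
    refine Submodule.span_mono ?_ h2
    rintro _ ⟨_, ⟨i, rfl⟩, rfl⟩
    exact (List.mem_ofFn' _ _).2 ⟨i, rfl⟩

theorem nd_fixed (Q : QuadraticForm F V) (hnd : ND Q) (T : Module.End F V)
    (hT : ∀ x y, polar Q (T x) (T y) = polar Q x y) (N : ℕ) (hN : (N : F) ≠ 0) (hTN : T ^ N = 1)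
    (u : V) (hu : T u = u) (huw : ∀ w, T w = w → polar Q u w = 0) : u = 0 := by
  refine hnd u fun y => ?_
  have h1 : T (∑ i ∈ Finset.range N, (T ^ i) y) = ∑ i ∈ Finset.range N, (T ^ i) y := by
    have e1 : ∑ i ∈ Finset.range N, (T ^ (i + 1)) y + (T ^ 0) y = ∑ i ∈ Finset.range N, (T ^ i) y + (T ^ N) y := by
      exact (Finset.sum_range_succ' (fun i => (T ^ i) y) N).symm.trans
        (Finset.sum_range_succ (fun i => (T ^ i) y) N)
    rw [hTN, pow_zero] at e1
    rw [map_sum]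
    refine Eq.trans (Finset.sum_congr rfl fun i _ => ?_) (add_right_cancel e1)
    rw [pow_succ', Module.End.mul_apply]
  have h2 : ∀ i, polar Q u ((T ^ i) y) = polar Q u y := by
    intro i
    induction i with
    | zero => rfl
    | succ i ih => rw [pow_succ', Module.End.mul_apply, ← ih, ← hT u ((T ^ i) y), hu]
  have h3 := huw _ h1
  rw [← polarBilin_apply_apply, map_sum] at h3
  simp only [polarBilin_apply_apply, h2, Finset.sum_const, Finset.card_range, nsmul_eq_mul] at h3
  exact (mul_eq_zero.1 h3).resolve_left hN

/-- Orthogonal decomposition data. -/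
structure Dec (Q : QuadraticForm F V) (T : Module.End F V) (V1 V2 W : Submodule F V) : Prop where
  t1 : ∀ x ∈ V1, T x = x
  t2 : ∀ x ∈ V2, T x = -x
  o12 : ∀ x ∈ V1, ∀ y ∈ V2, polar Q x y = 0
  o1W : ∀ x ∈ V1, ∀ y ∈ W, polar Q x y = 0
  o2W : ∀ x ∈ V2, ∀ y ∈ W, polar Q x y = 0
  dec : ∀ x, ∃ x1 ∈ V1, ∃ x2 ∈ V2, ∃ w ∈ W, x = x1 + x2 + w

theorem assemble (Q : QuadraticForm F V) (T : Module.End F V) (V1 V2 W : Submodule F V)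
    (h : Dec Q T V1 V2 W) (A C C' L L' : List V)
    (hA : GoodL Q A) (hC : GoodL Q C) (hC' : GoodL Q C') (hL : GoodL Q L) (hL' : GoodL Q L')
    (mA : ∀ x ∈ A, x ∈ V1) (mC : ∀ x ∈ C, x ∈ V2) (mC' : ∀ x ∈ C', x ∈ V2)
    (mL : ∀ x ∈ L, x ∈ W) (mL' : ∀ x ∈ L', x ∈ W) (rA : ∀ x, RL Q A (RL Q A x) = x)
    (rC : ∀ x ∈ V2, RL Q C' (RL Q C x) = -x) (rL : ∀ x ∈ W, RL Q L' (RL Q L x) = T x) :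
    GoodL Q (A ++ (C ++ L)) ∧ GoodL Q (A ++ (C' ++ L')) ∧
      ∀ x, RL Q (A ++ (C' ++ L')) (RL Q (A ++ (C ++ L)) x) = T x := by
  have good : ∀ C L : List V, GoodL Q C → GoodL Q L → (∀ x ∈ C, x ∈ V2) → (∀ x ∈ L, x ∈ W) →
      GoodL Q (A ++ (C ++ L)) := by
    intro C L hC hL mC mL
    refine GoodL_append Q _ _ hA (GoodL_append Q _ _ hC hL fun x hx y hy => h.o2W x (mC x hx) y (mL y hy)) ?_
    intro x hx y hy
    rcases List.mem_append.1 hy with hy | hy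
    · exact h.o12 x (mA x hx) y (mC y hy)
    · exact h.o1W x (mA x hx) y (mL y hy)
  have o21 : ∀ x ∈ V2, ∀ y ∈ V1, polar Q x y = 0 := fun x hx y hy => by rw [polar_comm]; exact h.o12 y hy x hx
  have oW1 : ∀ x ∈ W, ∀ y ∈ V1, polar Q x y = 0 := fun x hx y hy => by rw [polar_comm]; exact h.o1W y hy x hx
  have oW2 : ∀ x ∈ W, ∀ y ∈ V2, polar Q x y = 0 := fun x hx y hy => by rw [polar_comm]; exact h.o2W y hy x hx
  have fx : ∀ (M : List V) (X Y : Submodule F V), (∀ x ∈ M, x ∈ X) → (∀ x ∈ X, ∀ y ∈ Y, polar Q x y = 0) →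
      ∀ y ∈ Y, RL Q M y = y := fun M X Y hM hXY y hy => RL_fix _ _ _ fun e he => hXY e (hM e he) y hy
  refine ⟨good C L hC hL mC mL, good C' L' hC' hL' mC' mL', fun x => ?_⟩
  obtain ⟨x1, h1, x2, h2, w, hw, rfl⟩ := h.dec x
  simp only [RL_append, Module.End.mul_apply, map_add]
  have hA1 := RL_mem Q A V1 mA x1 h1
  have hC2 := RL_mem Q C V2 mC x2 h2
  have hLw := RL_mem Q L W mL w hw
  rw [fx L W V1 mL oW1 x1 h1, fx C V2 V1 mC o21 x1 h1, fx L' W V1 mL' oW1 _ hA1, fx C' V2 V1 mC' o21 _ hA1, rA,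
    fx L W V2 mL oW2 x2 h2, fx A V1 V2 mA h.o12 _ hC2, fx L' W V2 mL' oW2 _ hC2, rC x2 h2,
    fx A V1 V2 mA h.o12 _ (V2.neg_mem h2),
    fx C V2 W mC h.o2W _ hLw, fx A V1 W mA h.o1W _ hLw]
  have hLw' := RL_mem Q L' W mL' _ hLw
  rw [fx C' V2 W mC' h.o2W _ hLw', fx A V1 W mA h.o1W _ hLw', rL w hw, h.t1 x1 h1, h.t2 x2 h2]

theorem parity [FiniteDimensional F V] (hF2 : (2 : F) ≠ 0) (Q : QuadraticForm F V)
    (hQ : LinearMap.BilinForm.Nondegenerate (polarBilin Q)) (T : Module.End F V)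
    (t : (CliffordAlgebra Q)ˣ) (ht : (t : CliffordAlgebra Q) ∈ evenOdd Q 0)
    (hT : ∀ v, involute (t : CliffordAlgebra Q) * ι Q v = ι Q (T v) * t)
    (M : List V) (hM : ∀ x ∈ M, Q x ≠ 0) (hMT : ∀ v, RL Q M v = T v) : M.length % 2 = 0 := by
  obtain ⟨y, _, hy⟩ := sig_unit Q M hM
  obtain ⟨c, hc, htc⟩ := same_action hF2 Q hQ T t y hT (by
    intro v; rw [hy, RL_act Q M hM, hMT])
  by_contra hodd
  have h1 : (M.length : ZMod 2) = 1 := by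
    have : M.length % 2 = 1 := by omega
    rw [← ZMod.natCast_mod, this]; rfl
  have h2 : (t : CliffordAlgebra Q) ∈ evenOdd Q 1 := by
    rw [htc, hy, ← h1]; exact Submodule.smul_mem _ _ (sig_mem Q M)
  have h3 := Submodule.disjoint_def.1 (evenOdd_isCompl Q).disjoint _ ht h2
  have : Invertible (2 : F) := invertibleOfNonzero hF2
  have : Nontrivial (CliffordAlgebra Q) := inferInstance
  exact t.ne_zero h3

theorem univ2 [Finite F] (hF2 : (2 : F) ≠ 0) (p q r : F) (hp : p ≠ 0) (hq : q ≠ 0) :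
    ∃ a b : F, a * a * p + b * b * q = r := by
  obtain ⟨a, b, h⟩ := binK hF2 (-(q / p)) (r / p) (by simp [hp, hq])
  refine ⟨a, b, ?_⟩
  field_simp at h
  linear_combination h

end Part6

section Part7

open QuadraticMap Polynomial

theorem sqfree_S {F V : Type*} [Field F] [AddCommGroup V] [Module F V] [FiniteDimensional F V]
    (T Ti : Module.End F V) (N : ℕ) (hN : (N : F) ≠ 0) (hTN : T ^ N = 1) (hl : Ti * T = 1) :
    ∃ m : F[X], Squarefree m ∧ ∀ x, aeval (T + Ti) m x = 0 := by
  have hN0 : N ≠ 0 := by rintro rfl; simp at hN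
  have h1 : Squarefree (X ^ N - C (1 : F)) := (separable_X_pow_sub_C 1 hN one_ne_zero).squarefree
  have h2 : T.IsSemisimple := Module.End.isSemisimple_of_squarefree_aeval_eq_zero h1 (by simp [hTN])
  have h3 : Ti = T ^ (N - 1) := by
    calc Ti = Ti * T ^ N := by rw [hTN, mul_one]
      _ = Ti * (T * T ^ (N - 1)) := by rw [← pow_succ', Nat.sub_add_cancel (Nat.pos_of_ne_zero hN0)]
      _ = T ^ (N - 1) := by rw [← mul_assoc, hl, one_mul]
  have h4 : T + Ti = aeval T (X + X ^ (N - 1) : F[X]) := by simp [h3]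
  have h5 : (T + Ti).IsSemisimple := by rw [h4]; exact h2.aeval _
  exact ⟨minpoly F (T + Ti), h5.minpoly_squarefree, fun x => by rw [minpoly.aeval]; rfl⟩

theorem exists_Dec {F V : Type*} [Field F] [AddCommGroup V] [Module F V] [FiniteDimensional F V]
    (hF2 : (2 : F) ≠ 0) (Q : QuadraticForm F V) (hnd : ND Q) (T Ti : Module.End F V) (h : IT Q T Ti)
    (N : ℕ) (hN : (N : F) ≠ 0) (hTN : T ^ N = 1) :
    ∃ V1 V2 W : Submodule F V, Dec Q T V1 V2 W ∧
      (∀ u ∈ V1, (∀ w ∈ V1, polar Q u w = 0) → u = 0) ∧ (∀ u ∈ V2, (∀ w ∈ V2, polar Q u w = 0) → u = 0) ∧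
      (∀ u ∈ W, (∀ w ∈ W, polar Q u w = 0) → u = 0) ∧ (∀ w ∈ W, T w ∈ W) ∧ (∀ w ∈ W, Ti w ∈ W) ∧
      (∀ w ∈ W, T (T w) = w → w = 0) ∧
      Module.finrank F V = Module.finrank F V1 + Module.finrank F V2 + Module.finrank F W := by
  have hTT : ∀ x y, polar Q (T x) (T y) = polar Q x y := fun x y => by rw [h.adj, h.r]
  have m1 : ∀ x, x ∈ LinearMap.ker (T - 1) ↔ T x = x := fun x => by
    rw [LinearMap.mem_ker, LinearMap.sub_apply, sub_eq_zero]; rfl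
  have m2 : ∀ x, x ∈ LinearMap.ker (T + 1) ↔ T x = -x := fun x => by
    rw [LinearMap.mem_ker, LinearMap.add_apply, Module.End.one_apply, add_eq_zero_iff_eq_neg]
  set V1 := LinearMap.ker (T - 1)
  set V2 := LinearMap.ker (T + 1)
  have n1 : ∀ u ∈ V1, (∀ w ∈ V1, polar Q u w = 0) → u = 0 := fun u hu hw =>
    nd_fixed Q hnd T hTT N hN hTN u ((m1 u).1 hu) fun w hw' => hw w ((m1 w).2 hw')
  have n2 : ∀ u ∈ V2, (∀ w ∈ V2, polar Q u w = 0) → u = 0 := fun u hu hw =>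
    nd_fixed Q hnd (-T) (fun x y => by simp [hTT]) (2 * N) (by push_cast; exact mul_ne_zero hF2 hN)
      (by rw [pow_mul, neg_sq, ← pow_mul, mul_comm, pow_mul, hTN, one_pow]) u
      (by rw [LinearMap.neg_apply, (m2 u).1 hu, neg_neg])
      fun w hw' => hw w ((m2 w).2 (by rw [LinearMap.neg_apply] at hw'; rw [← neg_eq_iff_eq_neg]; exact hw'))
  have o12 : ∀ x ∈ V1, ∀ y ∈ V2, polar Q x y = 0 := by
    intro x hx y hy
    have e1 := hTT x y
    rw [(m1 x).1 hx, (m2 y).1 hy, polar_neg_right] at e1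
    have e2 : (2 : F) * polar Q x y = 0 := by linear_combination - e1
    exact (mul_eq_zero.1 e2).resolve_left hF2
  have nU : ∀ u ∈ V1 ⊔ V2, (∀ w ∈ V1 ⊔ V2, polar Q u w = 0) → u = 0 := by
    intro u hu hw
    obtain ⟨u1, h1, u2, h2, rfl⟩ := Submodule.mem_sup.1 hu
    have e1 : u1 = 0 := n1 u1 h1 fun w hw1 => by
      have := hw w (Submodule.mem_sup_left hw1)
      rwa [polar_add_left, polar_comm Q u2, o12 w hw1 u2 h2, add_zero] at this
    have e2 : u2 = 0 := n2 u2 h2 fun w hw1 => by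
      have := hw w (Submodule.mem_sup_right hw1)
      rwa [polar_add_left, o12 u1 h1 w hw1, zero_add] at this
    rw [e1, e2, add_zero]
  obtain ⟨W, hW, hc⟩ := orth_compl Q _ nU
  have hdec : ∀ x, ∃ x1 ∈ V1, ∃ x2 ∈ V2, ∃ w ∈ W, x = x1 + x2 + w := by
    intro x
    have : x ∈ V1 ⊔ V2 ⊔ W := by rw [hc.sup_eq_top]; trivial
    obtain ⟨u, hu, w, hw, rfl⟩ := Submodule.mem_sup.1 this
    obtain ⟨u1, h1, u2, h2, rfl⟩ := Submodule.mem_sup.1 hu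
    exact ⟨u1, h1, u2, h2, w, hw, rfl⟩
  have stT : ∀ u ∈ V1 ⊔ V2, T u ∈ V1 ⊔ V2 := by
    intro u hu
    obtain ⟨u1, h1, u2, h2, rfl⟩ := Submodule.mem_sup.1 hu
    rw [map_add, (m1 u1).1 h1, (m2 u2).1 h2]
    exact Submodule.add_mem_sup h1 (V2.neg_mem h2)
  have stTi : ∀ u ∈ V1 ⊔ V2, Ti u ∈ V1 ⊔ V2 := by
    intro u hu
    obtain ⟨u1, h1, u2, h2, rfl⟩ := Submodule.mem_sup.1 hu
    have e1 : Ti u1 = u1 := by conv_lhs => rw [← (m1 u1).1 h1, h.r]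
    have e2 : Ti u2 = -u2 := by
      have : u2 = -T u2 := by rw [(m2 u2).1 h2, neg_neg]
      conv_lhs => rw [this, map_neg, h.r]
    rw [map_add, e1, e2]
    exact Submodule.add_mem_sup h1 (V2.neg_mem h2)
  have oW : ∀ u ∈ V1 ⊔ V2, ∀ w ∈ W, polar Q u w = 0 := fun u hu w hw => (hW w).1 hw u hu
  refine ⟨V1, V2, W, ⟨fun x hx => (m1 x).1 hx, fun x hx => (m2 x).1 hx, o12,
    fun x hx y hy => oW x (Submodule.mem_sup_left hx) y hy,
    fun x hx y hy => oW x (Submodule.mem_sup_right hx) y hy, hdec⟩, n1, n2, ?_, ?_, ?_, ?_, ?_⟩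
  · intro u hu hw
    refine hnd u fun y => ?_
    obtain ⟨y1, h1, y2, h2, w, hw', rfl⟩ := hdec y
    rw [polar_add_right, hw w hw', polar_comm, oW _ (Submodule.add_mem_sup h1 h2) u hu, add_zero]
  · intro w hw
    rw [hW]
    intro u hu
    rw [← h.adj']; exact oW _ (stTi u hu) w hw
  · intro w hw
    rw [hW]
    intro u hu
    rw [← h.adj]; exact oW _ (stT u hu) w hw
  · intro w hw hww
    refine Submodule.disjoint_def.1 hc.disjoint w ?_ hw
    have e1 : w = (2⁻¹ : F) • (w + T w) + (2⁻¹ : F) • (w - T w) := by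
      rw [← smul_add, add_add_sub_cancel, ← two_smul F w, smul_smul, inv_mul_cancel₀ hF2, one_smul]
    rw [e1]
    refine Submodule.add_mem_sup ((m1 _).2 ?_) ((m2 _).2 ?_)
    · rw [map_smul, map_add, hww, add_comm]
    · rw [map_smul, map_sub, hww, ← smul_neg, neg_sub]
  · have d12 : V1 ⊓ V2 = ⊥ := by
      rw [eq_bot_iff]
      rintro x ⟨hx1, hx2⟩
      exact n2 x hx2 fun w hw => o12 x hx1 w hw
    have e1 := Submodule.finrank_add_eq_of_isCompl hc
    have e2 := Submodule.finrank_sup_add_finrank_inf_eq V1 V2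
    rw [d12, finrank_bot, add_zero] at e2
    omega

end Part7

section Part8

open QuadraticMap Polynomial

theorem main16 {F V : Type*} [Field F] [Finite F] [AddCommGroup V] [Module F V]
    [FiniteDimensional F V] (hF2 : (2 : F) ≠ 0) (Q : QuadraticForm F V)
    (hQ : LinearMap.BilinForm.Nondegenerate (QuadraticMap.polarBilin Q))
    (hdim : Module.finrank F V % 4 ≠ 2)
    (t : (CliffordAlgebra Q)ˣ) (ht : IsSpinElt Q t)
    (hss : Module.End.IsSemisimple (LinearMap.mulLeft F (t : CliffordAlgebra Q))) :
    ∃ s : (CliffordAlgebra Q)ˣ, IsSpinElt Q s ∧ s * t * s⁻¹ = t⁻¹ := by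
  have hnd : ND Q := fun x hx => hQ.1 x hx
  obtain ⟨Te, hTQ, hTact⟩ := lip_T hF2 Q t ht.1
  obtain ⟨N, hN, hTeN⟩ := order_T hF2 Q hQ Te t hTact hss
  obtain ⟨T, hTd⟩ : ∃ T : Module.End F V, T = (Te : V →ₗ[F] V) := ⟨_, rfl⟩
  obtain ⟨Ti, hTid⟩ : ∃ T : Module.End F V, T = (Te.symm : V →ₗ[F] V) := ⟨_, rfl⟩
  have hTTe : ∀ v, T v = Te v := fun v => by rw [hTd]; rfl
  have hTiTe : ∀ v, Ti v = Te.symm v := fun v => by rw [hTid]; rfl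
  have hpT : ∀ x y, polar Q (T x) (T y) = polar Q x y := fun x y => by
    simp only [polar, hTTe, ← map_add, hTQ]
  have hl : ∀ x, T (Ti x) = x := fun x => by rw [hTTe, hTiTe, LinearEquiv.apply_symm_apply]
  have hr : ∀ x, Ti (T x) = x := fun x => by rw [hTTe, hTiTe, LinearEquiv.symm_apply_apply]
  have h : IT Q T Ti := ⟨fun x y => by rw [← hpT x, hl], hl, hr⟩
  have hTN : T ^ N = 1 := by
    have : ∀ n : ℕ, ∀ v, (T ^ n) v = (Te ^ n) v := by
      intro n
      induction n with
      | zero => intro v; rfl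
      | succ n ih => intro v; rw [pow_succ, pow_succ, Module.End.mul_apply, ih, hTTe]; rfl
    ext v
    rw [this, hTeN]; rfl
  have hact : ∀ v, involute (t : CliffordAlgebra Q) * ι Q v = ι Q (T v) * t := fun v => by
    rw [hTact, hTTe]
  obtain ⟨m, hm, hmS⟩ := sqfree_S T Ti N hN hTN (by ext x; exact hr x)
  obtain ⟨V1, V2, W, D, n1, n2, nW, hWT, hWTi, hinj, hfr⟩ := exists_Dec hF2 Q hnd T Ti h N hN hTN
  obtain ⟨B1, hB1, mB1, lB1, sB1⟩ := ob_list hF2 Q V1 n1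
  obtain ⟨B2, hB2, mB2, lB2, sB2⟩ := ob_list hF2 Q V2 n2
  have hrB2 : ∀ x ∈ V2, RL Q B2 x = -x := fun x hx => RL_neg_span Q B2 hB2 x (sB2 hx)
  -- lists on W
  have hWl : ∀ c : F, c ≠ 0 → ∃ L L' : List V, GoodL Q L ∧ GoodL Q L' ∧ (∀ x ∈ L, x ∈ W) ∧ (∀ x ∈ L', x ∈ W) ∧
      Module.finrank F W = 2 * L.length ∧ Module.finrank F W = 2 * L'.length ∧
      (∀ w ∈ W, RL Q L' (RL Q L w) = T w) ∧ (0 < Module.finrank F W → IsSquare (c * (L.map Q).prod)) := by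
    intro c hc
    obtain ⟨M, M', hM, hM', hm1, hm1', hRM, hMsq⟩ := Ind hF2 (Module.finrank F W) W
      (Q.comp W.subtype) (T.restrict hWT) (Ti.restrict hWTi) rfl
      ⟨fun x y => h.adj x y, fun x => Subtype.ext (h.l x), fun x => Subtype.ext (h.r x)⟩
      (fun x hx => Subtype.ext (hinj x x.2 (congrArg Subtype.val hx)))
      (fun x hx => Subtype.ext (nW x x.2 fun w hw => hx ⟨w, hw⟩)) m hm
      (fun x => by
        apply Subtype.ext
        have := aeval_inter (T + Ti) (T.restrict hWT + Ti.restrict hWTi) W.subtype (fun x => rfl) m x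
        exact this.trans (hmS _)) c hc
    have hsub : ∀ x : W, Q (W.subtype x) = (Q.comp W.subtype) x := fun x => rfl
    have hMW : ∀ (N : List W), ∀ x ∈ N.map W.subtype, x ∈ W := by
      intro N x hx
      obtain ⟨y, _, rfl⟩ := List.mem_map.1 hx
      exact y.2
    have hMw : ∀ (N : List W) (w : W), RL Q (N.map W.subtype) w = RL (Q.comp W.subtype) N w :=
      fun N w => RL_map Q _ _ hsub N w
    refine ⟨M.map W.subtype, M'.map W.subtype, GoodL_map Q _ _ hsub _ hM, GoodL_map Q _ _ hsub _ hM',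
      hMW _, hMW _, by simpa using hm1, by simpa using hm1', ?_, ?_⟩
    · intro w hw
      rw [hMw M ⟨w, hw⟩, hMw, hRM]; rfl
    · intro hp
      rw [List.map_map]; exact hMsq hp
  have gnil : GoodL Q ([] : List V) := ⟨by simp, by simp⟩
  -- parity
  have hpar : B2.length % 2 = 0 := by
    obtain ⟨L, L', hL, hL', mL, mL', l1, l2, hR, -⟩ := hWl 1 one_ne_zero
    obtain ⟨g1, g2, hRR⟩ := assemble Q T V1 V2 W D [] [] B2 L L' gnil gnil hB2 hL hL' (by simp) (by simp) mB2
      mL mL' (fun x => rfl) (fun x hx => hrB2 x hx) hR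
    have := parity hF2 Q hQ T t ht.2.1 hact (([] ++ (B2 ++ L')) ++ ([] ++ ([] ++ L)))
      (fun x hx => (List.mem_append.1 hx).elim (g2.1 x) (g1.1 x)) (fun v => by
        rw [RL_append, Module.End.mul_apply, hRR])
    simp only [List.length_append, List.length_nil] at this
    omega
  have key : ∃ A C C' L L' : List V, GoodL Q A ∧ GoodL Q C ∧ GoodL Q C' ∧ GoodL Q L ∧ GoodL Q L' ∧
      (∀ x ∈ A, x ∈ V1) ∧ (∀ x ∈ C, x ∈ V2) ∧ (∀ x ∈ C', x ∈ V2) ∧ (∀ x ∈ L, x ∈ W) ∧ (∀ x ∈ L', x ∈ W) ∧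
      (∀ x, RL Q A (RL Q A x) = x) ∧ (∀ x ∈ V2, RL Q C' (RL Q C x) = -x) ∧
      (∀ x ∈ W, RL Q L' (RL Q L x) = T x) ∧
      (A.length + C.length + L.length) % 2 = 0 ∧
      (A.length + C.length + L.length) % 4 = (A.length + C'.length + L'.length) % 4 ∧
      IsSquare ((A.map Q).prod * ((C.map Q).prod * (L.map Q).prod)) := by
    have single : ∀ v, v ∈ B1 → GoodL Q [v] ∧ (∀ x ∈ [v], x ∈ V1) ∧ ∀ x, RL Q [v] (RL Q [v] x) = x := by
      intro v hv
      refine ⟨⟨by simpa using hB1.1 v hv, by simp⟩, by simpa using mB1 v hv, fun x => ?_⟩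
      simp only [RL_cons, RL_nil, mul_one]
      exact refl'_refl' Q v x (hB1.1 v hv)
    obtain ⟨k, hk⟩ : ∃ k, B2.length = 2 * k := ⟨B2.length / 2, by omega⟩
    rcases Nat.eq_zero_or_pos (Module.finrank F W) with hW0 | hWpos
    · have hWz : ∀ x ∈ W, RL Q [] (RL Q [] x) = T x := by
        intro x hx
        rw [Submodule.finrank_eq_zero.1 hW0, Submodule.mem_bot] at hx
        simp [hx]
      rcases Nat.even_or_odd k with hkev | hkodd
      · refine ⟨[], [], B2, [], [], gnil, gnil, hB2, gnil, gnil, by simp, by simp, mB2, by simp, by simp,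
          fun x => rfl, fun x hx => hrB2 x hx, hWz, by simp, ?_, by simp⟩
        obtain ⟨j, hj⟩ := hkev
        simp only [List.length_nil]; omega
      · obtain ⟨j, hj⟩ := hkodd
        have hB1pos : B1 ≠ [] := by
          rintro rfl
          simp only [List.length_nil] at lB1
          omega
        obtain ⟨v, B1', rfl⟩ := List.exists_cons_of_ne_nil hB1pos
        obtain ⟨sv1, sv2, sv3⟩ := single v (by simp)
        have hQv : Q v ≠ 0 := hB1.1 v (by simp)
        match B2, hk, hB2, mB2, sB2 with
        | [], hk, _, _, _ => simp at hk; omega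
        | [e], hk, _, _, _ => simp at hk; omega
        | e1 :: e2 :: R, hk, hB2, mB2, sB2 =>
          have q1 : Q e1 ≠ 0 := hB2.1 e1 (by simp)
          have q2 : Q e2 ≠ 0 := hB2.1 e2 (by simp)
          have hp1 := List.pairwise_cons.1 hB2.2
          have hp2 := List.pairwise_cons.1 hp1.2
          have p12 : polar Q e1 e2 = 0 := hp1.1 e2 (by simp)
          have p21 : polar Q e2 e1 = 0 := by rw [polar_comm]; exact p12
          have p11 : polar Q e1 e1 = 2 * Q e1 := by rw [polar_self]; simp
          have p22 : polar Q e2 e2 = 2 * Q e2 := by rw [polar_self]; simp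
          obtain ⟨a, b, hab⟩ := univ2 hF2 (Q e1) (Q e2) (Q v) q1 q2
          have Qlin : ∀ x y : F, Q (x • e1 + y • e2) = x * x * Q e1 + y * y * Q e2 := by
            intro x y
            have : polar Q (x • e1) (y • e2) = 0 := by simp [p12]
            rw [polar, sub_sub, sub_eq_zero] at this
            rw [this, QuadraticMap.map_smul, QuadraticMap.map_smul]; rfl
          have hu : Q (a • e1 + b • e2) = Q v := by rw [Qlin, hab]
          have hu' : Q ((b * Q e2) • e1 + (-(a * Q e1)) • e2) = Q e1 * Q e2 * Q v := by
            rw [Qlin, ← hab]; ring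
          have puu : polar Q (a • e1 + b • e2) ((b * Q e2) • e1 + (-(a * Q e1)) • e2) = 0 := by
            simp only [polar_add_left, polar_add_right, polar_smul_left, polar_smul_right, p12, p21, p11, p22,
              smul_eq_mul]
            ring
          have m1 : e1 ∈ V2 := mB2 e1 (by simp)
          have m2 : e2 ∈ V2 := mB2 e2 (by simp)
          have i1 : Q v • e1 = (a * Q e1) • (a • e1 + b • e2) + b • ((b * Q e2) • e1 + (-(a * Q e1)) • e2) := by
            rw [← hab]; module
          have i2 : Q v • e2 = (b * Q e2) • (a • e1 + b • e2) - a • ((b * Q e2) • e1 + (-(a * Q e1)) • e2) := by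
            rw [← hab]; module
          have mu : a • e1 + b • e2 ∈ V2 := V2.add_mem (V2.smul_mem _ m1) (V2.smul_mem _ m2)
          have mu' : (b * Q e2) • e1 + (-(a * Q e1)) • e2 ∈ V2 :=
            V2.add_mem (V2.smul_mem _ m1) (V2.smul_mem _ m2)
          have oR : ∀ x y : F, ∀ z ∈ R, polar Q (x • e1 + y • e2) z = 0 := by
            intro x y z hz
            rw [polar_add_left, polar_smul_left, polar_smul_left, hp1.1 z (by simp [hz]), hp2.1 z hz]; simp
          have ou := oR a b
          have ou' := oR (b * Q e2) (-(a * Q e1))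
          generalize a • e1 + b • e2 = u at *
          generalize (b * Q e2) • e1 + (-(a * Q e1)) • e2 = u' at *
          have hQu' : Q u' ≠ 0 := by rw [hu']; exact mul_ne_zero (mul_ne_zero q1 q2) hQv
          have gR : GoodL Q (u' :: R) := by
            refine ⟨?_, List.pairwise_cons.2 ⟨ou', hp2.2⟩⟩
            intro x hx
            rcases List.mem_cons.1 hx with rfl | hx
            · exact hQu'
            · exact hB2.1 x (by simp [hx])
          have gu : GoodL Q [u] := ⟨by simpa [hu] using hQv, by simp⟩
          have gall : GoodL Q ((u' :: R) ++ [u]) := by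
            refine GoodL_append Q _ _ gR gu ?_
            intro x hx y hy
            rw [List.mem_singleton] at hy
            subst hy
            rw [polar_comm]
            rcases List.mem_cons.1 hx with rfl | hx
            · exact puu
            · exact ou x hx
          have hspan : ∀ x ∈ V2, x ∈ Submodule.span F {x | x ∈ (u' :: R) ++ [u]} := by
            intro x hx
            have su : u ∈ Submodule.span F {x | x ∈ (u' :: R) ++ [u]} := Submodule.subset_span (by simp)
            have su' : u' ∈ Submodule.span F {x | x ∈ (u' :: R) ++ [u]} := Submodule.subset_span (by simp)
            refine (Submodule.span_le.2 ?_) (sB2 hx)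
            intro y hy
            have hy' : y = e1 ∨ y = e2 ∨ y ∈ R := by simpa using hy
            rcases hy' with rfl | rfl | hy
            · rw [SetLike.mem_coe, ← Submodule.smul_mem_iff _ hQv, i1]
              exact Submodule.add_mem _ (Submodule.smul_mem _ _ su) (Submodule.smul_mem _ _ su')
            · rw [SetLike.mem_coe, ← Submodule.smul_mem_iff _ hQv, i2]
              exact Submodule.sub_mem _ (Submodule.smul_mem _ _ su) (Submodule.smul_mem _ _ su')
            · exact Submodule.subset_span (by simp [hy])
          refine ⟨[v], [u], u' :: R, [], [], sv1, gu, gR, gnil, gnil, sv2, by simpa using mu, ?_, by simp,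
            by simp, sv3, ?_, hWz, by simp, ?_, ?_⟩
          · intro x hx
            rcases List.mem_cons.1 hx with rfl | hx
            · exact mu'
            · exact mB2 x (by simp [hx])
          · intro x hx
            rw [← Module.End.mul_apply, ← RL_append]
            exact RL_neg_span Q _ gall x (hspan x hx)
          · simp only [List.length_cons, List.length_nil] at hk ⊢; omega
          · simp [hu]
    · obtain ⟨A, hA, mA, rA, lA⟩ : ∃ A : List V, GoodL Q A ∧ (∀ x ∈ A, x ∈ V1) ∧
          (∀ x, RL Q A (RL Q A x) = x) ∧ (2 * A.length + 2 * k + Module.finrank F W) % 4 = 0 := by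
        obtain ⟨L0, -, -, -, -, -, l0, -⟩ := hWl 1 one_ne_zero
        by_cases hj : (2 * k + Module.finrank F W) % 4 = 0
        · exact ⟨[], gnil, by simp, fun x => rfl, by simpa using hj⟩
        · have hB1pos : B1 ≠ [] := by
            rintro rfl
            simp only [List.length_nil] at lB1
            omega
          obtain ⟨v, B1', rfl⟩ := List.exists_cons_of_ne_nil hB1pos
          obtain ⟨sv1, sv2, sv3⟩ := single v (by simp)
          exact ⟨[v], sv1, sv2, sv3, by simp only [List.length_cons, List.length_nil]; omega⟩
      have gsub : ∀ M : List V, M.Sublist B2 → GoodL Q M ∧ ∀ x ∈ M, x ∈ V2 := fun M hM =>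
        ⟨⟨fun x hx => hB2.1 x (hM.subset hx), hB2.2.sublist hM⟩, fun x hx => mB2 x (hM.subset hx)⟩
      obtain ⟨g1, mm1⟩ := gsub (B2.drop k) (List.drop_sublist _ _)
      obtain ⟨g2, mm2⟩ := gsub (B2.take k) (List.take_sublist _ _)
      have pne : ∀ M : List V, GoodL Q M → (M.map Q).prod ≠ 0 := by
        intro M hM
        rw [Ne, List.prod_eq_zero_iff, List.mem_map]
        rintro ⟨e, he, h0⟩
        exact hM.1 e he h0
      obtain ⟨L, L', hL, hL', mL, mL', l1, l2, hR, hsq⟩ := hWl _ (mul_ne_zero (pne A hA) (pne _ g1))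
      refine ⟨A, B2.drop k, B2.take k, L, L', hA, g1, g2, hL, hL', mA, mm1, mm2, mL, mL', rA, ?_, hR, ?_, ?_, ?_⟩
      · intro x hx
        rw [← Module.End.mul_apply, ← RL_append, List.take_append_drop]
        exact hrB2 x hx
      · rw [List.length_drop]; omega
      · rw [List.length_drop, List.length_take]; omega
      · rw [← mul_assoc]; exact hsq hWpos
  obtain ⟨A, C, C', L, L', hA, hC, hC', hL, hL', mA, mC, mC', mL, mL', rA, rC, rL, hl1, hl2, hsq⟩ := key
  obtain ⟨g1, g2, hRR⟩ := assemble Q T V1 V2 W D A C C' L L' hA hC hC' hL hL' mA mC mC' mL mL' rA rC rL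
  refine final_lemma hF2 Q hQ T t ht hact _ _ g1 g2 hRR ?_ ?_ ?_
  · simp only [List.length_append]; omega
  · simp only [List.length_append]; omega
  · simpa only [List.map_append, List.prod_append] using hsq

end Part8

/-- Over a finite field of characteristic `≠ 2` with `q` nondegenerate
and `dim V ≡ 0, 1, 3 (mod 4)`, every semisimple element of `Spin(V,q)` is real in
`Spin(V,q)`. -/
theorem stmt16 {F V : Type*} [Field F] [Finite F] [AddCommGroup V] [Module F V]
    [FiniteDimensional F V] (hF2 : (2 : F) ≠ 0) (Q : QuadraticForm F V)
    (hQ : LinearMap.BilinForm.Nondegenerate (QuadraticMap.polarBilin Q))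
    (hdim : Module.finrank F V % 4 = 0 ∨ Module.finrank F V % 4 = 1 ∨
      Module.finrank F V % 4 = 3)
    (t : (CliffordAlgebra Q)ˣ) (ht : IsSpinElt Q t)
    (hss : Module.End.IsSemisimple (LinearMap.mulLeft F (t : CliffordAlgebra Q))) :
    ∃ s : (CliffordAlgebra Q)ˣ, IsSpinElt Q s ∧ s * t * s⁻¹ = t⁻¹ := by
  exact main16 hF2 Q hQ (by omega) t ht hss
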